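/- arXiv:1509.06394 — 3 statements merged into one kernel-verified Lean document; each statement's English description precedes it below -/
import Mathlib

section
/- If Q(G) is Archimedean and the Slater condition holds for the LSIPP problem (P), then the moment relaxation values p^mom_k, k ≥ d_P, are nonincreasing in k, satisfy p^mom_k ≥ p* for every k, and converge to p* as k → ∞. -/
open MvPolynomial

/-- A polynomial is a sum of squares. -/
def SOSPoly {n : ℕ} (p : MvPolynomial (Fin n) ℝ) : Prop :=
  ∃ (t : ℕ) (q : Fin t → MvPolynomial (Fin n) ℝ), p = ∑ i, q i ^ 2

/-- Membership in the quadratic module Q(G) generated by `g`. -/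
def QModMem {n s : ℕ} (g : Fin s → MvPolynomial (Fin n) ℝ)
    (p : MvPolynomial (Fin n) ℝ) : Prop :=
  ∃ (σ₀ : MvPolynomial (Fin n) ℝ) (σ : Fin s → MvPolynomial (Fin n) ℝ),
    SOSPoly σ₀ ∧ (∀ j, SOSPoly (σ j)) ∧ p = σ₀ + ∑ j, σ j * g j

/-- The basic semialgebraic index set S. -/
def indexSet {n s : ℕ} (g : Fin s → MvPolynomial (Fin n) ℝ) : Set (Fin n → ℝ) :=
  {y | ∀ j, 0 ≤ eval y (g j)}

/-- Feasibility for the LSIPP problem (P): a(y)ᵀx + b(y) ≥ 0 for all y ∈ S. -/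
def isFeasible {n m s : ℕ} (a : Fin m → MvPolynomial (Fin n) ℝ)
    (b : MvPolynomial (Fin n) ℝ) (g : Fin s → MvPolynomial (Fin n) ℝ)
    (x : Fin m → ℝ) : Prop :=
  ∀ y ∈ indexSet g, 0 ≤ (∑ i, x i * eval y (a i)) + eval y b

/-- The quadratic module Q(G) is Archimedean. -/
def QMArchimedean {n s : ℕ} (g : Fin s → MvPolynomial (Fin n) ℝ) : Prop :=
  ∃ ψ : MvPolynomial (Fin n) ℝ, QModMem g ψ ∧
    IsCompact {y : Fin n → ℝ | 0 ≤ eval y ψ}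

/-- Membership in the k-th truncated quadratic module Q_k(G). -/
def QModMemK {n s : ℕ} (g : Fin s → MvPolynomial (Fin n) ℝ) (k : ℕ)
    (p : MvPolynomial (Fin n) ℝ) : Prop :=
  ∃ (σ₀ : MvPolynomial (Fin n) ℝ) (σ : Fin s → MvPolynomial (Fin n) ℝ),
    SOSPoly σ₀ ∧ (∀ j, SOSPoly (σ j)) ∧ σ₀.totalDegree ≤ 2 * k ∧
    (∀ j, (σ j * g j).totalDegree ≤ 2 * k) ∧ p = σ₀ + ∑ j, σ j * g j

/-- ⌈d/2⌉ for natural d. -/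
def halfCeil (d : ℕ) : ℕ := (d + 1) / 2

/-- d_S = max{1, d_1, …, d_s}. -/
def dS {n s : ℕ} (g : Fin s → MvPolynomial (Fin n) ℝ) : ℕ :=
  max 1 (Finset.univ.sup fun j => halfCeil (g j).totalDegree)

/-- d_P = max{d_S, ⌈deg a_i / 2⌉, ⌈deg b / 2⌉}. -/
def dP {n m s : ℕ} (a : Fin m → MvPolynomial (Fin n) ℝ)
    (b : MvPolynomial (Fin n) ℝ) (g : Fin s → MvPolynomial (Fin n) ℝ) : ℕ :=
  max (max (dS g) (Finset.univ.sup fun i => halfCeil (a i).totalDegree))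
    (halfCeil b.totalDegree)

/-- The Riesz functional L_z(p) = Σ_α p_α z_α. -/
noncomputable def rieszFun {n : ℕ} (z : (Fin n →₀ ℕ) → ℝ)
    (p : MvPolynomial (Fin n) ℝ) : ℝ :=
  ∑ α ∈ p.support, p.coeff α * z α

/-- The finite set of multi-indices α with |α| ≤ t. -/
noncomputable def monLE (n t : ℕ) : Finset (Fin n →₀ ℕ) :=
  ((Fintype.piFinset fun _ : Fin n => Finset.range (t + 1)).filter
    fun a => ∑ i, a i ≤ t).image fun a => Finsupp.equivFunOnFinite.symm a

/-- The moment matrix M_k(z), with (α,β)-entry z_{α+β} for |α|, |β| ≤ k. -/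
noncomputable def momentMat (n k : ℕ) (z : (Fin n →₀ ℕ) → ℝ) :
    Matrix ↥(monLE n k) ↥(monLE n k) ℝ :=
  fun I J => z (I.1 + J.1)

/-- The localizing matrix M_t(f z), with (α,β)-entry Σ_γ f_γ z_{α+β+γ} for |α|, |β| ≤ t. -/
noncomputable def localizingMat (n t : ℕ) (f : MvPolynomial (Fin n) ℝ)
    (z : (Fin n →₀ ℕ) → ℝ) :
    Matrix ↥(monLE n t) ↥(monLE n t) ℝ :=
  fun I J => ∑ γ ∈ f.support, f.coeff γ * z (I.1 + J.1 + γ)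

/-- Feasibility for the k-th moment relaxation. -/
def momFeas {n m s : ℕ} (c : Fin m → ℝ) (a : Fin m → MvPolynomial (Fin n) ℝ)
    (g : Fin s → MvPolynomial (Fin n) ℝ) (k : ℕ) (z : (Fin n →₀ ℕ) → ℝ) : Prop :=
  (∀ i, rieszFun z (a i) = c i) ∧ (momentMat n k z).PosSemidef ∧
    ∀ j, (localizingMat n (k - halfCeil (g j).totalDegree) (g j) z).PosSemidef

/-- The k-th moment relaxation value p^mom_k (as an extended real, −∞ if infeasible). -/
noncomputable def pmom {n m s : ℕ} (c : Fin m → ℝ) (a : Fin m → MvPolynomial (Fin n) ℝ)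
    (b : MvPolynomial (Fin n) ℝ) (g : Fin s → MvPolynomial (Fin n) ℝ) (k : ℕ) : EReal :=
  sSup ((fun z : (Fin n →₀ ℕ) → ℝ => ((-(rieszFun z b) : ℝ) : EReal)) ''
    {z | momFeas c a g k z})

/-- The intermediate value property for polynomials over an ordered field. -/
def HasPolyIVT (K : Type*) [Field K] [LinearOrder K] : Prop :=
  ∀ (p : Polynomial K) (a b : K), a < b → p.eval a * p.eval b < 0 →
    ∃ c, a < c ∧ c < b ∧ p.eval c = 0

section SquareCone

variable {B R R' : Type*} [CommRing B] [CommRing R] [CommRing R']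

/-- Sums of elements `ρ t * e ^ 2` with `t ∈ T` and `e ∈ S`. -/
def sqCone (T : Subsemiring B) (ρ : B →+* R) (S : Set R) : AddSubmonoid R :=
  AddSubmonoid.closure {x | ∃ t ∈ T, ∃ e ∈ S, x = ρ t * e ^ 2}

lemma mul_sq_mem_sqCone {T : Subsemiring B} {ρ : B →+* R} {S : Set R} {t : B} {e : R}
    (ht : t ∈ T) (he : e ∈ S) : ρ t * e ^ 2 ∈ sqCone T ρ S :=
  AddSubmonoid.subset_closure ⟨t, ht, e, he, rfl⟩

lemma map_mem_sqCone {T : Subsemiring B} {ρ : B →+* R} {S : Set R} {S' : Set R'}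
    (φ : R →+* R') (hS : ∀ e ∈ S, φ e ∈ S') {x : R} (hx : x ∈ sqCone T ρ S) :
    φ x ∈ sqCone T (φ.comp ρ) S' := by
  induction hx using AddSubmonoid.closure_induction with
  | mem x hx =>
    obtain ⟨t, ht, e, he, rfl⟩ := hx
    simpa using mul_sq_mem_sqCone (ρ := φ.comp ρ) ht (hS e he)
  | zero => simp
  | add x y _ _ hx hy => simpa using add_mem hx hy

lemma exists_map_eq_of_mem_sqCone {T : Subsemiring B} {ρ : B →+* R} {S : Set R} {S' : Set R'}
    (φ : R →+* R') (hS : ∀ e' ∈ S', ∃ e ∈ S, φ e = e') {x : R'}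
    (hx : x ∈ sqCone T (φ.comp ρ) S') : ∃ y ∈ sqCone T ρ S, φ y = x := by
  induction hx using AddSubmonoid.closure_induction with
  | mem x hx =>
    obtain ⟨t, ht, e, he, rfl⟩ := hx
    obtain ⟨e, he', rfl⟩ := hS e he
    exact ⟨_, mul_sq_mem_sqCone ht he', by simp⟩
  | zero => exact ⟨0, zero_mem _, map_zero _⟩
  | add x y _ _ hx hy =>
    obtain ⟨x, hx, rfl⟩ := hx
    obtain ⟨y, hy, rfl⟩ := hy
    exact ⟨x + y, add_mem hx hy, map_add _ _ _⟩

lemma sqCone_mono {T : Subsemiring B} {ρ : B →+* R} {S S' : Set R} (h : S ⊆ S') :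
    sqCone T ρ S ≤ sqCone T ρ S' :=
  AddSubmonoid.closure_mono fun _ ⟨t, ht, e, he, hx⟩ => ⟨t, ht, e, h he, hx⟩

lemma mul_mem_sqCone_univ {T : Subsemiring B} {ρ : B →+* R} {x y : R}
    (hx : x ∈ sqCone T ρ Set.univ) (hy : y ∈ sqCone T ρ Set.univ) :
    x * y ∈ sqCone T ρ Set.univ := by
  induction hx using AddSubmonoid.closure_induction with
  | mem x hx =>
    obtain ⟨t, ht, e, he, rfl⟩ := hx
    induction hy using AddSubmonoid.closure_induction with
    | mem y hy =>
      obtain ⟨t', ht', e', he', rfl⟩ := hy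
      have := mul_sq_mem_sqCone (ρ := ρ) (mul_mem ht ht') (Set.mem_univ (e * e'))
      rw [map_mul] at this
      convert this using 1
      ring
    | zero => simp
    | add x y _ _ hx hy => rw [mul_add]; exact add_mem hx hy
  | zero => simp
  | add x y _ _ hx hy => rw [add_mul]; exact add_mem hx hy

lemma sq_mem_sqCone_univ {T : Subsemiring B} {ρ : B →+* R} (x : R) :
    x ^ 2 ∈ sqCone T ρ Set.univ := by
  simpa using mul_sq_mem_sqCone (ρ := ρ) (one_mem T) (Set.mem_univ x)

lemma mem_sqCone_univ_of_mem {T : Subsemiring B} {ρ : B →+* R} {t : B} (ht : t ∈ T) :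
    ρ t ∈ sqCone T ρ Set.univ := by
  simpa using mul_sq_mem_sqCone (ρ := ρ) ht (Set.mem_univ 1)

end SquareCone

section RealClosed

variable {B E : Type*} [CommRing B] [Field E]

lemma natDegree_le_of_mem_sqCone {T : Subsemiring B} {ρ : B →+* E} {d : ℕ}
    {G : Polynomial E}
    (hG : G ∈ sqCone T ((Polynomial.C).comp ρ) {f | f.natDegree ≤ d}) :
    G.natDegree ≤ 2 * d := by
  induction hG using AddSubmonoid.closure_induction with
  | mem x hx =>
    obtain ⟨t, ht, e, he, rfl⟩ := hx
    refine (Polynomial.natDegree_C_mul_le _ _).trans (Polynomial.natDegree_pow_le.trans ?_)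
    exact Nat.mul_le_mul_left _ he
  | zero => simp
  | add x y _ _ hx hy => exact (Polynomial.natDegree_add_le _ _).trans (max_le hx hy)

lemma coeff_two_mem_sqCone {T : Subsemiring B} {ρ : B →+* E} {G : Polynomial E}
    (hG : G ∈ sqCone T ((Polynomial.C).comp ρ) {f | f.natDegree ≤ 1}) :
    G.coeff 2 ∈ sqCone T ρ Set.univ := by
  induction hG using AddSubmonoid.closure_induction with
  | mem x hx =>
    obtain ⟨t, ht, e, he, rfl⟩ := hx
    have := Polynomial.coeff_pow_of_natDegree_le (m := 2) he
    rw [RingHom.comp_apply, Polynomial.coeff_C_mul, show 2 = 2 * 1 from rfl, this]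
    exact mul_sq_mem_sqCone ht (Set.mem_univ _)
  | zero => simp
  | add x y _ _ hx hy => simpa using add_mem hx hy

lemma eval_mem_sqCone {T : Subsemiring B} {ρ : B →+* E} {S : Set (Polynomial E)}
    {G : Polynomial E} (hG : G ∈ sqCone T ((Polynomial.C).comp ρ) S) (c : E) :
    G.eval c ∈ sqCone T ρ Set.univ := by
  have := map_mem_sqCone (Polynomial.evalRingHom c) (S' := Set.univ) (fun _ _ => trivial) hG
  have h2 : (Polynomial.evalRingHom c).comp (Polynomial.C.comp ρ) = ρ := by ext; simp
  rwa [h2] at this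

/-- A relation `-1 = ∑ ρ t * e ^ 2` modulo `p` lifts to a relation between polynomials of
small degree. -/
lemma exists_polynomial_of_neg_one_mem {T : Subsemiring B} {ρ : B →+* E} {p : Polynomial E}
    (hp : 0 < p.natDegree)
    (h : (-1 : AdjoinRoot p) ∈ sqCone T ((AdjoinRoot.of p).comp ρ) Set.univ) :
    ∃ G ∈ sqCone T ((Polynomial.C).comp ρ) {f | f.natDegree ≤ p.natDegree - 1}, p ∣ G + 1 := by
  have h' : (AdjoinRoot.of p).comp ρ = (AdjoinRoot.mk p).comp (Polynomial.C.comp ρ) := rfl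
  rw [h'] at h
  obtain ⟨G, hG, hG1⟩ := exists_map_eq_of_mem_sqCone (AdjoinRoot.mk p)
    (S := {f | f.natDegree ≤ p.natDegree - 1}) (fun e _ => by
      obtain ⟨f, rfl⟩ := AdjoinRoot.mk_surjective e
      refine ⟨f % p, ?_, ?_⟩
      · have := Polynomial.natDegree_mod_lt f hp.ne'
        simp only [Set.mem_ofPred_eq]
        omega
      · rw [AdjoinRoot.mk_eq_mk]
        exact ⟨-(f / p), by linear_combination (EuclideanDomain.div_add_mod f p)⟩) h
  refine ⟨G, hG, ?_⟩
  rw [← AdjoinRoot.mk_eq_zero, map_add, hG1]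
  simp

/-- A field in which no proper simple algebraic extension keeps `T` a proper preordering is
ordered with `T` nonnegative. -/
lemma mem_or_neg_mem_sqCone {T : Subsemiring B} {ρ : B →+* E}
    (h1 : (-1 : E) ∉ sqCone T ρ Set.univ)
    (hmax : ∀ p : Polynomial E, Irreducible p → 2 ≤ p.natDegree →
      (-1 : AdjoinRoot p) ∈ sqCone T ((AdjoinRoot.of p).comp ρ) Set.univ) (a : E) :
    a ∈ sqCone T ρ Set.univ ∨ -a ∈ sqCone T ρ Set.univ := by
  by_cases ha : ∃ r, r ^ 2 = a
  · obtain ⟨r, rfl⟩ := ha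
    exact Or.inl (sq_mem_sqCone_univ r)
  right
  have hdeg : (Polynomial.X ^ 2 - Polynomial.C a).natDegree = 2 :=
    Polynomial.natDegree_X_pow_sub_C
  have hirr : Irreducible (Polynomial.X ^ 2 - Polynomial.C a) := by
    refine (Polynomial.irreducible_iff_roots_eq_zero_of_degree_le_three (by omega) (by omega)).2 ?_
    refine Multiset.eq_zero_of_forall_notMem fun r hr => ha ⟨r, ?_⟩
    have := (Polynomial.mem_roots'.1 hr).2
    simp only [Polynomial.IsRoot.def, Polynomial.eval_sub, Polynomial.eval_pow,
      Polynomial.eval_X, Polynomial.eval_C] at this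
    linear_combination this
  obtain ⟨G, hG, g, hg⟩ := exists_polynomial_of_neg_one_mem (by omega)
    (hmax _ hirr (by omega))
  rw [hdeg] at hG
  have hG2 := natDegree_le_of_mem_sqCone hG
  have hc := coeff_two_mem_sqCone hG
  have h0 := eval_mem_sqCone hG 0
  have hg0 : g.natDegree = 0 := by
    by_contra hne
    have hg' : g ≠ 0 := by rintro rfl; simp at hne
    have h3 := Polynomial.natDegree_mul hirr.ne_zero hg'
    rw [← hg, hdeg] at h3
    have h4 := Polynomial.natDegree_add_le G 1
    simp only [Polynomial.natDegree_one] at h4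
    have : max G.natDegree 0 ≤ 2 := by simpa using hG2
    omega
  obtain ⟨γ, rfl⟩ := Polynomial.natDegree_eq_zero.1 hg0
  have e2 : G.coeff 2 = γ := by
    have := congrArg (fun q => Polynomial.coeff q 2) hg
    simpa [Polynomial.coeff_one, Polynomial.coeff_C] using this
  have e0 : G.eval 0 + 1 = -a * γ := by
    have := congrArg (Polynomial.eval 0) hg
    simpa using this
  have hγ : γ ≠ 0 := by
    rintro rfl
    apply h1
    rw [mul_zero, add_eq_zero_iff_eq_neg] at e0
    rwa [e0] at h0
  have : -a = (G.eval 0 + 1 ^ 2) * (G.coeff 2 * γ⁻¹ ^ 2) := by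
    rw [one_pow, e0, e2]; field_simp
  rw [this]
  exact mul_mem_sqCone_univ (add_mem h0 (sq_mem_sqCone_univ 1))
    (mul_mem_sqCone_univ hc (sq_mem_sqCone_univ _))

lemma zero_le_of_mem_sqCone [LinearOrder E] [IsStrictOrderedRing E] {T : Subsemiring B}
    {ρ : B →+* E} (hT : ∀ t ∈ T, 0 ≤ ρ t) {x : E} (hx : x ∈ sqCone T ρ Set.univ) : 0 ≤ x := by
  induction hx using AddSubmonoid.closure_induction with
  | mem x hx =>
    obtain ⟨t, ht, e, he, rfl⟩ := hx
    exact mul_nonneg (hT t ht) (sq_nonneg e)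
  | zero => exact le_rfl
  | add x y _ _ hx hy => exact add_nonneg hx hy

lemma hasPolyIVT_of_maximal [LinearOrder E] [IsStrictOrderedRing E] {T : Subsemiring B}
    {ρ : B →+* E} (hT : ∀ t ∈ T, 0 ≤ ρ t)
    (hmax : ∀ p : Polynomial E, Irreducible p → 2 ≤ p.natDegree →
      (-1 : AdjoinRoot p) ∈ sqCone T ((AdjoinRoot.of p).comp ρ) Set.univ) : HasPolyIVT E := by
  intro p
  induction hd : p.natDegree using Nat.strong_induction_on generalizing p with
  | _ d ih =>
  intro a b hab hp
  have hp0 : p ≠ 0 := by rintro rfl; simp at hp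
  have hpu : ¬ IsUnit p := by
    intro hu
    obtain ⟨r, -, rfl⟩ := Polynomial.isUnit_iff.1 hu
    simp only [Polynomial.eval_C] at hp
    nlinarith [mul_self_nonneg r]
  by_cases hirr : Irreducible p
  · rcases lt_or_ge p.natDegree 2 with h2 | h2
    · have h1 : p.natDegree = 1 := by
        have := hirr.natDegree_pos
        omega
      obtain ⟨u, hu, v, rfl⟩ := Polynomial.natDegree_eq_one.1 h1
      simp only [Polynomial.eval_add, Polynomial.eval_mul, Polynomial.eval_C,
        Polynomial.eval_X] at hp ⊢
      refine ⟨-v / u, ?_, ?_, by field_simp; ring⟩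
      · by_contra! h
        have ha : (u * a + v) = u * (a - -v / u) := by field_simp; ring
        have hb : (u * b + v) = u * (b - -v / u) := by field_simp; ring
        rw [ha, hb] at hp
        nlinarith [mul_nonneg (sub_nonneg.2 h) (sub_nonneg.2 (h.trans hab.le)), sq_nonneg u,
          mul_nonneg (sq_nonneg u) (mul_nonneg (sub_nonneg.2 h) (sub_nonneg.2 (h.trans hab.le)))]
      · by_contra! h
        have ha : (u * a + v) = u * (a - -v / u) := by field_simp; ring
        have hb : (u * b + v) = u * (b - -v / u) := by field_simp; ring
        rw [ha, hb] at hp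
        nlinarith [mul_nonneg (sq_nonneg u)
          (mul_nonneg (sub_nonneg.2 h) (sub_nonneg.2 (hab.le.trans h)))]
    · obtain ⟨G, hG, g, hg⟩ := exists_polynomial_of_neg_one_mem (by omega) (hmax p hirr h2)
      have hGd := natDegree_le_of_mem_sqCone hG
      have hev (c : E) : 0 < p.eval c * g.eval c := by
        have := zero_le_of_mem_sqCone hT (eval_mem_sqCone hG c)
        have h3 := congrArg (Polynomial.eval c) hg
        simp only [Polynomial.eval_add, Polynomial.eval_one, Polynomial.eval_mul] at h3
        linarith
      have hg0 : g ≠ 0 := by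
        rintro rfl
        simpa using hev a
      have hgd : g.natDegree < d := by
        have h3 := Polynomial.natDegree_mul hp0 hg0
        rw [← hg] at h3
        have h4 := Polynomial.natDegree_add_le G 1
        simp only [Polynomial.natDegree_one] at h4
        have : max G.natDegree 0 ≤ 2 * (p.natDegree - 1) := by simpa using hGd
        omega
      obtain ⟨c, -, -, hc⟩ := ih _ hgd g rfl a b hab (by
        have h3 := mul_pos (hev a) (hev b)
        by_contra! h4
        nlinarith [mul_nonneg h4 (neg_nonneg.2 hp.le)])
      have := hev c
      simp [hc] at this
  · simp only [irreducible_iff, not_and, not_forall, not_or] at hirr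
    obtain ⟨p₁, p₂, rfl, h₁, h₂⟩ := hirr hpu
    have hne := mul_ne_zero_iff.1 hp0
    have hdeg := Polynomial.natDegree_mul hne.1 hne.2
    have pos {q : Polynomial E} (hq : q ≠ 0) (hu : ¬ IsUnit q) : 0 < q.natDegree := by
      rw [Nat.pos_iff_ne_zero]
      intro h0
      obtain ⟨r, rfl⟩ := Polynomial.natDegree_eq_zero.1 h0
      exact hu (Polynomial.isUnit_C.2 (isUnit_iff_ne_zero.2 (by simpa using hq)))
    have d1 := pos hne.1 h₁
    have d2 := pos hne.2 h₂
    simp only [Polynomial.eval_mul] at hp ⊢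
    rcases lt_or_ge (p₁.eval a * p₁.eval b) 0 with h | h
    · obtain ⟨c, hac, hcb, hc⟩ := ih _ (by omega) p₁ rfl a b hab h
      exact ⟨c, hac, hcb, by simp [hc]⟩
    · obtain ⟨c, hac, hcb, hc⟩ := ih _ (by omega) p₂ rfl a b hab (by
        by_contra! h4
        nlinarith [mul_nonneg h h4])
      exact ⟨c, hac, hcb, by simp [hc]⟩

theorem exists_ordered_of_maximal {T : Subsemiring B} {ρ : B →+* E}
    (h1 : (-1 : E) ∉ sqCone T ρ Set.univ)
    (hmax : ∀ p : Polynomial E, Irreducible p → 2 ≤ p.natDegree →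
      (-1 : AdjoinRoot p) ∈ sqCone T ((AdjoinRoot.of p).comp ρ) Set.univ) :
    ∃ (_ : LinearOrder E) (_ : IsStrictOrderedRing E), HasPolyIVT E ∧ ∀ t ∈ T, 0 ≤ ρ t := by
  classical
  let C : RingCone E :=
    { sqCone T ρ Set.univ with
      mul_mem' := mul_mem_sqCone_univ
      one_mem' := by simpa using sq_mem_sqCone_univ (1 : E)
      eq_zero_of_mem_of_neg_mem' := fun {a} ha hna => by
        by_contra h0
        apply h1
        have : (-1 : E) = a * (-a * (a⁻¹) ^ 2) := by field_simp
        rw [this]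
        exact mul_mem_sqCone_univ ha (mul_mem_sqCone_univ hna (sq_mem_sqCone_univ _)) }
  have hC : ∀ x, x ∈ C ↔ x ∈ sqCone T ρ Set.univ := fun x => Iff.rfl
  have : HasMemOrNegMem C := ⟨fun a => mem_or_neg_mem_sqCone h1 hmax a⟩
  let : LinearOrder E := LinearOrder.mkOfAddGroupCone C
  have : IsOrderedRing E := IsOrderedRing.mkOfCone C
  have : IsStrictOrderedRing E := IsOrderedRing.toIsStrictOrderedRing E
  have hT : ∀ t ∈ T, 0 ≤ ρ t := fun t ht => by
    change ρ t - 0 ∈ C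
    rw [sub_zero, hC]
    exact mem_sqCone_univ_of_mem ht
  exact ⟨inferInstance, inferInstance, hasPolyIVT_of_maximal hT hmax, hT⟩

end RealClosed

section PrimeIdeal

variable {B : Type*} [CommRing B]

/-- A proper preordering is proper modulo some prime ideal, and its supporting ideal there is
trivial. -/
lemma exists_prime_of_neg_one_notMem {T : Subsemiring B} (hsq : ∀ b : B, b ^ 2 ∈ T)
    (h1 : (-1 : B) ∉ T) :
    ∃ P : Ideal B, P.IsPrime ∧ ∀ t ∈ T, ∀ s : B, s ^ 2 + t ∈ P → s ∈ P := by
  obtain ⟨P, -, hP⟩ := zorn_le_nonempty₀ {I : Ideal B | ∀ t ∈ T, 1 + t ∉ I} (by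
    intro c hc hchain I hI
    refine ⟨sSup c, fun t ht hmem => ?_, fun J hJ => le_sSup hJ⟩
    obtain ⟨J, hJ, htJ⟩ := (Submodule.mem_sSup_of_directed ⟨I, hI⟩ hchain.directedOn).1 hmem
    exact hc hJ t ht htJ) ⊥ (by
    intro t ht h
    apply h1
    rw [Ideal.mem_bot, add_eq_zero_iff_eq_neg, eq_comm] at h
    rwa [← h, neg_neg] at *)
  have hPg : ∀ t ∈ T, 1 + t ∉ P := hP.prop
  have key (x : B) (hx : x ∉ P) : ∃ t ∈ T, ∃ b, 1 + t + x * b ∈ P := by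
    by_contra! hcon
    have : (P ⊔ Ideal.span {x}) ≤ P := hP.le_of_ge (fun t ht hmem => by
      obtain ⟨p, hp, q, hq, hpq⟩ := Submodule.mem_sup.1 hmem
      obtain ⟨b, rfl⟩ := Ideal.mem_span_singleton'.1 hq
      apply hcon t ht (-b)
      have : 1 + t + x * -b = p := by linear_combination -hpq
      rwa [this]) le_sup_left
    exact hx (this (Ideal.mem_sup_right (Ideal.mem_span_singleton_self x)))
  refine ⟨P, ⟨?_, ?_⟩, ?_⟩
  · rintro rfl
    exact hPg 0 (zero_mem _) trivial
  · intro x y hxy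
    by_contra! h
    obtain ⟨t₁, ht₁, b₁, h₁⟩ := key x h.1
    obtain ⟨t₂, ht₂, b₂, h₂⟩ := key y h.2
    refine hPg (t₁ + t₂ + t₁ * t₂) (add_mem (add_mem ht₁ ht₂) (mul_mem ht₁ ht₂)) ?_
    have : 1 + (t₁ + t₂ + t₁ * t₂) = (1 + t₂) * (1 + t₁ + x * b₁)
        - (x * b₁) * (1 + t₂ + y * b₂) + b₁ * b₂ * (x * y) := by ring
    rw [this]
    exact add_mem (sub_mem (P.mul_mem_left _ h₁) (P.mul_mem_left _ h₂)) (P.mul_mem_left _ hxy)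
  · intro t ht s hs
    by_contra h
    obtain ⟨u, hu, b, hb⟩ := key s h
    refine hPg (u + u + u ^ 2 + t * b ^ 2)
      (add_mem (add_mem (add_mem hu hu) (hsq u)) (mul_mem ht (hsq b))) ?_
    have : 1 + (u + u + u ^ 2 + t * b ^ 2)
        = (1 + u - s * b) * (1 + u + s * b) + b ^ 2 * (s ^ 2 + t) := by ring
    rw [this]
    exact add_mem (P.mul_mem_left _ hb) (P.mul_mem_left _ hs)

end PrimeIdeal

section Zorn

variable {B A : Type*} [CommRing B] [Field A]

lemma exists_mem_of_mem_sqCone_sSup {T : Subsemiring B} {ρ : B →+* A} {c : Set (Subfield A)}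
    (hne : c.Nonempty) (hc : IsChain (· ≤ ·) c) {x : A}
    (hx : x ∈ sqCone T ρ (sSup c : Subfield A)) : ∃ F ∈ c, x ∈ sqCone T ρ (F : Set A) := by
  induction hx using AddSubmonoid.closure_induction with
  | mem x hx =>
    obtain ⟨t, ht, e, he, rfl⟩ := hx
    obtain ⟨F, hF, he⟩ := (Subfield.mem_sSup_of_directedOn hne hc.directedOn).1 he
    exact ⟨F, hF, mul_sq_mem_sqCone ht he⟩
  | zero => exact ⟨_, hne.some_mem, zero_mem _⟩
  | add x y _ _ hx hy =>
    obtain ⟨F, hF, hx⟩ := hx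
    obtain ⟨G, hG, hy⟩ := hy
    obtain ⟨H, hH, hFH, hGH⟩ := hc.directedOn F hF G hG
    exact ⟨H, hH, add_mem (sqCone_mono hFH hx) (sqCone_mono hGH hy)⟩

lemma exists_maximal_subfield [IsAlgClosed A] {T : Subsemiring B} {ρ : B →+* A}
    {F₀ : Subfield A} (hρ : ∀ b, ρ b ∈ F₀) (h1 : (-1 : A) ∉ sqCone T ρ F₀) :
    ∃ (F : Subfield A) (σ : B →+* F), (-1 : F) ∉ sqCone T σ Set.univ ∧
      ∀ p : Polynomial F, Irreducible p → 2 ≤ p.natDegree →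
      (-1 : AdjoinRoot p) ∈ sqCone T ((AdjoinRoot.of p).comp σ) Set.univ := by
  obtain ⟨F, hF₀, hF⟩ := zorn_le_nonempty₀ {F : Subfield A | (-1 : A) ∉ sqCone T ρ F} (by
    intro c hc hchain I hI
    refine ⟨sSup c, fun hmem => ?_, fun J hJ => le_sSup hJ⟩
    obtain ⟨F, hF, hmem⟩ := exists_mem_of_mem_sqCone_sSup ⟨I, hI⟩ hchain hmem
    exact hc hF hmem) F₀ h1
  let σ : B →+* F := ρ.codRestrict F fun b => hF₀ (hρ b)
  have hσ : F.subtype.comp σ = ρ := rfl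
  refine ⟨F, σ, fun h => ?_, fun p hp hdeg => ?_⟩
  · have := map_mem_sqCone F.subtype (S' := (F : Set A)) (fun e _ => e.2) h
    rw [hσ, map_neg, map_one] at this
    exact hF.prop this
  · have : Fact (Irreducible p) := ⟨hp⟩
    obtain ⟨θ, hθ⟩ := IsAlgClosed.exists_eval₂_eq_zero F.subtype p hp.degree_pos.ne'
    let φ : AdjoinRoot p →+* A := AdjoinRoot.lift F.subtype θ hθ
    have hφof (x : F) : φ (AdjoinRoot.of p x) = x := AdjoinRoot.lift_of hθ
    have hle : F ≤ φ.fieldRange := fun x hx => ⟨AdjoinRoot.of p ⟨x, hx⟩, hφof _⟩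
    have hnle : ¬ φ.fieldRange ≤ F := by
      intro h
      have hθF : θ ∈ F := h ⟨AdjoinRoot.root p, AdjoinRoot.lift_root hθ⟩
      have hroot : p.IsRoot ⟨θ, hθF⟩ := by
        have : F.subtype (p.eval ⟨θ, hθF⟩) = 0 := by
          rw [← Polynomial.eval₂_at_apply]; exact hθ
        exact (map_eq_zero _).1 this
      have : p.natDegree = 1 := Polynomial.natDegree_eq_of_degree_eq_some
        (Polynomial.degree_eq_one_of_irreducible_of_root hp hroot)
      omega
    have hmem : (-1 : A) ∈ sqCone T ρ φ.fieldRange := by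
      by_contra hcon
      exact hnle (hF.le_of_ge hcon hle)
    have hcomp : φ.comp ((AdjoinRoot.of p).comp σ) = ρ := by
      ext b
      exact hφof _
    rw [← hcomp] at hmem
    obtain ⟨y, hy, hy1⟩ := exists_map_eq_of_mem_sqCone φ (S := Set.univ)
      (S' := (φ.fieldRange : Set A))
      (fun e he => by obtain ⟨x, hx⟩ := he; exact ⟨x, trivial, hx⟩) hmem
    have : y = -1 := φ.injective (by rw [hy1, map_neg, map_one])
    rwa [this] at hy

end Zorn

universe u in
/-- A ring with a proper preordering maps to an ordered field with the intermediate value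
property for polynomials. -/
theorem exists_hom_to_polyIVT_field {B : Type u} [CommRing B] {T : Subsemiring B}
    (hsq : ∀ b : B, b ^ 2 ∈ T) (h1 : (-1 : B) ∉ T) [Countable B] :
    ∃ (E : Type u) (_ : Field E) (_ : LinearOrder E) (_ : IsStrictOrderedRing E) (ρ : B →+* E),
      HasPolyIVT E ∧ (∀ t ∈ T, 0 ≤ ρ t) ∧ Countable E := by
  obtain ⟨P, hP, hPT⟩ := exists_prime_of_neg_one_notMem hsq h1
  let K := FractionRing (B ⧸ P)
  let A := AlgebraicClosure K
  let ρK : B →+* K := (algebraMap (B ⧸ P) K).comp (Ideal.Quotient.mk P)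
  let ρ : B →+* A := (algebraMap K A).comp ρK
  have hρK (b : B) : ρK b = 0 ↔ b ∈ P := by
    simp only [ρK, RingHom.comp_apply]
    rw [FaithfulSMul.algebraMap_eq_zero_iff, Ideal.Quotient.eq_zero_iff_mem]
  have hK (x : K) (hx : x ∈ sqCone T ρK Set.univ) :
      ∃ t ∈ T, ∃ s ∉ P, x * ρK s ^ 2 = ρK t := by
    induction hx using AddSubmonoid.closure_induction with
    | mem x hx =>
      obtain ⟨t, ht, e, -, rfl⟩ := hx
      obtain ⟨b', s', hs', rfl⟩ := IsFractionRing.div_surjective (A := B ⧸ P) e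
      obtain ⟨b, rfl⟩ := Ideal.Quotient.mk_surjective b'
      obtain ⟨s, rfl⟩ := Ideal.Quotient.mk_surjective s'
      have hs : s ∉ P := by
        rw [← Ideal.Quotient.eq_zero_iff_mem]
        exact nonZeroDivisors.ne_zero hs'
      refine ⟨t * b ^ 2, mul_mem ht (hsq b), s, hs, ?_⟩
      change ρK t * (ρK b / ρK s) ^ 2 * ρK s ^ 2 = _
      have : ρK s ≠ 0 := by rwa [Ne, hρK]
      rw [map_mul, map_pow, div_pow, mul_assoc, div_mul_cancel₀ _ (pow_ne_zero 2 this)]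
    | zero => exact ⟨0, zero_mem _, 1, fun h => hP.ne_top ((Ideal.eq_top_iff_one _).2 h), by simp⟩
    | add x y _ _ hx hy =>
      obtain ⟨t, ht, s, hs, hx⟩ := hx
      obtain ⟨t', ht', s', hs', hy⟩ := hy
      refine ⟨t * s' ^ 2 + t' * s ^ 2, add_mem (mul_mem ht (hsq _)) (mul_mem ht' (hsq _)),
        s * s', hP.mul_notMem hs hs', ?_⟩
      simp only [map_mul, map_add, map_pow]
      linear_combination (ρK s') ^ 2 * hx + (ρK s) ^ 2 * hy
  have hA : (-1 : A) ∉ sqCone T ρ (algebraMap K A).fieldRange := by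
    intro h
    obtain ⟨y, hy, hy1⟩ := exists_map_eq_of_mem_sqCone (algebraMap K A) (S := Set.univ)
      (S' := ((algebraMap K A).fieldRange : Set A))
      (fun e he => by obtain ⟨x, hx⟩ := he; exact ⟨x, trivial, hx⟩) h
    have : y = -1 := (algebraMap K A).injective (by rw [hy1, map_neg, map_one])
    subst this
    obtain ⟨t, ht, s, hs, hst⟩ := hK _ hy
    refine hs (hPT t ht s ((hρK _).1 ?_))
    rw [map_add, map_pow]
    linear_combination -hst
  obtain ⟨F, σ, hF1, hF⟩ := exists_maximal_subfield (F₀ := (algebraMap K A).fieldRange)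
    (fun b => ⟨ρK b, rfl⟩) hA
  obtain ⟨o, so, hivt, hT⟩ := exists_ordered_of_maximal hF1 hF
  refine ⟨F, inferInstance, o, so, σ, hivt, hT, ?_⟩
  have hcB : Countable (B ⧸ P) := Ideal.Quotient.mk_surjective.countable
  have hcK : Countable K := by
    have : Function.Surjective fun x : (B ⧸ P) × (B ⧸ P) => algebraMap (B ⧸ P) K x.1 /
        algebraMap (B ⧸ P) K x.2 := fun e => by
      obtain ⟨a, b, -, h⟩ := IsFractionRing.div_surjective (A := B ⧸ P) e
      exact ⟨(a, b), h⟩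
    exact this.countable
  have hcA : Countable A := by
    rw [← Cardinal.mk_le_aleph0_iff] at hcK ⊢
    exact (Algebra.IsAlgebraic.cardinalMk_le_max K A).trans (max_le hcK le_rfl)
  infer_instance

section IVT

variable {K : Type*} [Field K] [LinearOrder K] [IsStrictOrderedRing K]

lemma HasPolyIVT.sign_eval_eq (hK : HasPolyIVT K) {p : Polynomial K} {a b : K} (hab : a ≤ b)
    (hp : ∀ c, a ≤ c → c ≤ b → p.eval c ≠ 0) :
    SignType.sign (p.eval a) = SignType.sign (p.eval b) := by
  rcases hab.eq_or_lt with rfl | hab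
  · rfl
  have ha := hp a le_rfl hab.le
  have hb := hp b hab.le le_rfl
  have h : ¬ p.eval a * p.eval b < 0 := fun h => by
    obtain ⟨c, hac, hcb, hc⟩ := hK p a b hab h
    exact hp c hac.le hcb.le hc
  rcases ha.lt_or_gt with ha' | ha' <;> rcases hb.lt_or_gt with hb' | hb'
  · rw [sign_neg ha', sign_neg hb']
  · exact absurd (mul_neg_of_neg_of_pos ha' hb') h
  · exact absurd (mul_neg_of_pos_of_neg ha' hb') h
  · rw [sign_pos ha', sign_pos hb']

/-- Rolle's theorem for polynomials with the intermediate value property, between consecutive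
roots. -/
lemma HasPolyIVT.exists_derivative_eq_zero_aux (hK : HasPolyIVT K) {p : Polynomial K}
    (hp : p ≠ 0) {x y : K} (hxy : x < y) (hx : p.eval x = 0) (hy : p.eval y = 0)
    (hno : ∀ c, x < c → c < y → p.eval c ≠ 0) :
    ∃ z, x < z ∧ z < y ∧ p.derivative.eval z = 0 := by
  obtain ⟨q, hpq, hq⟩ := Polynomial.exists_eq_pow_rootMultiplicity_mul_and_not_dvd p hp x
  set m := p.rootMultiplicity x with hm
  have hm0 : m ≠ 0 := ((Polynomial.rootMultiplicity_pos hp).2 hx).ne'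
  have hq0 : q ≠ 0 := by rintro rfl; simp at hq
  obtain ⟨r, hqr, hr⟩ := Polynomial.exists_eq_pow_rootMultiplicity_mul_and_not_dvd q hq0 y
  set k := q.rootMultiplicity y with hk
  have hqy : q.IsRoot y := by
    rw [hpq, Polynomial.eval_mul] at hy
    refine (mul_eq_zero.1 hy).resolve_left ?_
    simpa using pow_ne_zero _ (sub_pos.2 hxy).ne'
  have hk0 : k ≠ 0 := ((Polynomial.rootMultiplicity_pos hq0).2 hqy).ne'
  rw [Polynomial.dvd_iff_isRoot] at hq hr
  have hrx : r.eval x ≠ 0 := fun h => hq (by rw [hqr]; simp [h])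
  obtain ⟨m', hm'⟩ := Nat.exists_eq_succ_of_ne_zero hm0
  obtain ⟨k', hk'⟩ := Nat.exists_eq_succ_of_ne_zero hk0
  have hsign : SignType.sign (r.eval x) = SignType.sign (r.eval y) := by
    refine hK.sign_eval_eq hxy.le fun c hxc hcy hc => ?_
    rcases hxc.eq_or_lt with rfl | hxc
    · exact hrx hc
    rcases hcy.eq_or_lt with rfl | hcy
    · exact hr hc
    exact hno c hxc hcy (by rw [hpq, hqr]; simp [hc])
  let s : Polynomial K := ((m' + 1 : K) • (Polynomial.X - Polynomial.C y) +
    (k' + 1 : K) • (Polynomial.X - Polynomial.C x)) * r +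
    (Polynomial.X - Polynomial.C x) * (Polynomial.X - Polynomial.C y) * r.derivative
  have hder : p.derivative = (Polynomial.X - Polynomial.C x) ^ m' *
      (Polynomial.X - Polynomial.C y) ^ k' * s := by
    rw [hpq, hqr, hm', hk']
    simp only [s, Polynomial.derivative_mul, Polynomial.derivative_X_sub_C_pow,
      Polynomial.smul_eq_C_mul, Nat.succ_eq_add_one, Nat.add_sub_cancel, Nat.cast_add,
      Nat.cast_one, Polynomial.C_add, Polynomial.C_1, map_natCast]
    ring
  have hsx : s.eval x = (m' + 1) * (x - y) * r.eval x := by simp [s]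
  have hsy : s.eval y = (k' + 1) * (y - x) * r.eval y := by simp [s]
  have hrr : 0 < r.eval x * r.eval y := by
    rw [← sign_eq_one_iff, sign_mul, hsign, ← sign_mul, sign_eq_one_iff]
    exact mul_self_pos.2 hr
  obtain ⟨z, hxz, hzy, hz⟩ := hK s x y hxy (by
    rw [hsx, hsy]
    have h1 : (0 : K) < (m' + 1) * (k' + 1) := by positivity
    have h2 : 0 < (y - x) * (y - x) := mul_self_pos.2 (sub_pos.2 hxy).ne'
    have := mul_pos (mul_pos h1 h2) hrr
    linarith)
  exact ⟨z, hxz, hzy, by rw [hder]; simp [hz]⟩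

/-- Rolle's theorem for polynomials over a field with the intermediate value property. -/
lemma HasPolyIVT.exists_derivative_eq_zero (hK : HasPolyIVT K) {p : Polynomial K}
    (hp : p ≠ 0) {x y : K} (hxy : x < y) (hx : p.eval x = 0) (hy : p.eval y = 0) :
    ∃ z, x < z ∧ z < y ∧ p.derivative.eval z = 0 := by
  obtain ⟨w, hw, hmin⟩ := Finset.exists_min_image (p.roots.toFinset.filter (x < ·)) id
    ⟨y, by simp [hp, hy, hxy]⟩
  simp only [Finset.mem_filter, Multiset.mem_toFinset, Polynomial.mem_roots hp,
    Polynomial.IsRoot.def, id] at hw hmin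
  obtain ⟨z, hxz, hzw, hz⟩ := hK.exists_derivative_eq_zero_aux hp hw.2 hx hw.1
    fun c hxc hcw hc => (hmin c ⟨hc, hxc⟩).not_gt hcw
  exact ⟨z, hxz, hzw.trans_le (hmin y ⟨hy, hxy⟩), hz⟩

/-- A polynomial changes sign around a root with no critical points nearby. -/
lemma HasPolyIVT.eval_mul_eval_neg (hK : HasPolyIVT K) {p : Polynomial K} (hp : p ≠ 0)
    {u α v : K} (hu : u < α) (hv : α < v) (hα : p.eval α = 0)
    (hder : ∀ c, u < c → c < v → p.derivative.eval c ≠ 0) : p.eval u * p.eval v < 0 := by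
  have hnu : p.eval u ≠ 0 := fun h => by
    obtain ⟨z, h1, h2, h3⟩ := hK.exists_derivative_eq_zero hp hu h hα
    exact hder z h1 (h2.trans hv) h3
  have hnv : p.eval v ≠ 0 := fun h => by
    obtain ⟨z, h1, h2, h3⟩ := hK.exists_derivative_eq_zero hp hv hα h
    exact hder z (hu.trans h1) h2 h3
  by_contra! hcon
  have hpos : 0 < p.eval u * p.eval v := lt_of_le_of_ne hcon (mul_ne_zero hnu hnv).symm
  obtain ⟨h, rfl⟩ := Polynomial.dvd_iff_isRoot.2 hα
  simp only [Polynomial.eval_mul, Polynomial.eval_sub, Polynomial.eval_X, Polynomial.eval_C]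
    at hpos
  have h0 : h.eval u * h.eval v < 0 := by
    have h1 : 0 < (α - u) * (v - α) := mul_pos (sub_pos.2 hu) (sub_pos.2 hv)
    by_contra! h2
    nlinarith [mul_nonneg h1.le h2]
  obtain ⟨c, huc, hcv, hc⟩ := hK h u v (hu.trans hv) h0
  have hcr : ((Polynomial.X - Polynomial.C α) * h).eval c = 0 := by simp [hc]
  rcases lt_trichotomy c α with hcα | rfl | hcα
  · obtain ⟨z, h1, h2, h3⟩ := hK.exists_derivative_eq_zero hp hcα hcr hα
    exact hder z (huc.trans h1) (h2.trans hv) h3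
  · exact hder c hu hv (by simp [Polynomial.derivative_mul, hc])
  · obtain ⟨z, h1, h2, h3⟩ := hK.exists_derivative_eq_zero hp hcα hα hcr
    exact hder z (hu.trans h1) (h2.trans hcv) h3

end IVT

section SignCompat

variable {Γ K L : Type*} [CommRing Γ] [Field K] [LinearOrder K]
  [IsStrictOrderedRing K] [Field L] [LinearOrder L] [IsStrictOrderedRing L]

/-- All roots of nonzero polynomials of degree less than `d` lie in the base ring. -/
def RootsLift (f : Γ →+* K) (d : ℕ) : Prop :=
  ∀ q : Polynomial Γ, q ≠ 0 → q.natDegree < d → ∀ x, q.eval₂ f x = 0 → ∃ γ, f γ = x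

lemma sign_eval₂_eq (hK : HasPolyIVT K) {f : Γ →+* K} (hf : Function.Injective f)
    {d : ℕ} (hd : RootsLift f d) {q : Polynomial Γ} (hq : q.natDegree < d)
    (hroot : ∀ γ, q.eval γ ≠ 0) (α : K) :
    SignType.sign (q.eval₂ f α) = SignType.sign (f (q.eval 0)) := by
  have hq0 : q ≠ 0 := by rintro rfl; simpa using hroot 0
  have hno (c : K) : (q.map f).eval c ≠ 0 := fun h => by
    rw [Polynomial.eval_map] at h
    obtain ⟨γ, rfl⟩ := hd q hq0 hq c h
    rw [Polynomial.eval₂_at_apply] at h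
    exact hroot γ (hf (by rw [h, map_zero]))
  have h0 : f (q.eval 0) = (q.map f).eval 0 := by simp
  rw [h0, ← Polynomial.eval_map]
  rcases le_total α 0 with h | h
  · exact hK.sign_eval_eq h fun c _ _ => hno c
  · exact (hK.sign_eval_eq h fun c _ _ => hno c).symm

/-- Matching cuts give matching signs of polynomials. -/
lemma sign_eval₂_eq_of_cut [IsDomain Γ] (hK : HasPolyIVT K) (hL : HasPolyIVT L)
    {f : Γ →+* K} {g : Γ →+* L}
    (hf : Function.Injective f) (hg : Function.Injective g)
    (hfg : ∀ γ, SignType.sign (f γ) = SignType.sign (g γ)) {d : ℕ} (hdf : RootsLift f d)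
    (hdg : RootsLift g d) {α : K} {β : L}
    (hcut : ∀ γ, SignType.sign (α - f γ) = SignType.sign (β - g γ)) (q : Polynomial Γ)
    (hq : q.natDegree < d) :
    SignType.sign (q.eval₂ f α) = SignType.sign (q.eval₂ g β) := by
  induction hn : q.natDegree using Nat.strong_induction_on generalizing q with
  | _ n ih =>
  by_cases hroot : ∃ γ, q.eval γ = 0
  · obtain ⟨γ, hγ⟩ := hroot
    obtain ⟨r, rfl⟩ := Polynomial.dvd_iff_isRoot.2 hγ
    rcases eq_or_ne r 0 with rfl | hr
    · simp
    have := Polynomial.natDegree_mul (Polynomial.X_sub_C_ne_zero γ) hr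
    rw [Polynomial.natDegree_X_sub_C] at this
    simp only [Polynomial.eval₂_mul, Polynomial.eval₂_sub, Polynomial.eval₂_X,
      Polynomial.eval₂_C, sign_mul]
    rw [hcut, ih _ (by omega) r (by omega) rfl]
  · push Not at hroot
    rw [sign_eval₂_eq hK hf hdf hq hroot, sign_eval₂_eq hL hg hdg hq hroot, hfg]

lemma exists_gt_root {f : Γ →+* K} {q : Polynomial Γ} (hq : q.Monic) {α : K}
    (hα : q.eval₂ f α = 0) : ∃ γ, |α| < f γ := by
  refine ⟨1 + ∑ i ∈ Finset.range q.natDegree, (q.coeff i ^ 2 + 1), ?_⟩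
  simp only [map_add, map_one, map_sum, map_pow]
  by_contra! h
  have hs : ∑ i ∈ Finset.range q.natDegree, |f (q.coeff i)| ≤
      ∑ i ∈ Finset.range q.natDegree, (f (q.coeff i) ^ 2 + 1) :=
    Finset.sum_le_sum fun i _ => by
      rw [← sq_abs]
      nlinarith [sq_nonneg (|f (q.coeff i)| - 1), abs_nonneg (f (q.coeff i))]
  have hs0 : 0 ≤ ∑ i ∈ Finset.range q.natDegree, |f (q.coeff i)| :=
    Finset.sum_nonneg fun i _ => abs_nonneg _
  have h1 : 1 ≤ |α| := by linarith
  rw [Polynomial.eval₂_eq_sum_range, Finset.sum_range_succ, hq.coeff_natDegree, map_one,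
    one_mul, add_comm, add_eq_zero_iff_eq_neg] at hα
  have hn : q.natDegree ≠ 0 := by
    intro h0
    rw [h0] at hα
    simp at hα
  obtain ⟨n, hn⟩ := Nat.exists_eq_succ_of_ne_zero hn
  have h2 : |α| ^ (n + 1) ≤ (∑ i ∈ Finset.range q.natDegree, |f (q.coeff i)|) * |α| ^ n := by
    rw [← abs_pow, ← Nat.succ_eq_add_one, ← hn, hα, abs_neg, Finset.sum_mul]
    refine (Finset.abs_sum_le_sum_abs _ _).trans (Finset.sum_le_sum fun i hi => ?_)
    rw [abs_mul, abs_pow]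
    refine mul_le_mul_of_nonneg_left (pow_le_pow_right₀ h1 ?_) (abs_nonneg _)
    have := Finset.mem_range.1 hi
    omega
  rw [pow_succ, mul_comm] at h2
  have h3 : 0 < |α| ^ n := by positivity
  have := le_of_mul_le_mul_right h2 h3
  linarith

/-- A root over `K` of minimal degree is matched by a root over `L` with the same cut. -/
lemma exists_root_of_cut [IsDomain Γ] (hK : HasPolyIVT K) (hL : HasPolyIVT L)
    {f : Γ →+* K} {g : Γ →+* L}
    (hf : Function.Injective f)
    (hfg : ∀ γ, SignType.sign (f γ) = SignType.sign (g γ)) {q : Polynomial Γ} (hq : q.Monic)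
    (hdf : RootsLift f q.natDegree) {α : K} (hα : q.eval₂ f α = 0) (hαf : ∀ γ, f γ ≠ α) :
    ∃ β, q.eval₂ g β = 0 ∧ ∀ γ, SignType.sign (α - f γ) = SignType.sign (β - g γ) := by
  classical
  have hlt (x y : Γ) : f x < f y ↔ g x < g y := by
    rw [← sub_pos, ← sub_pos (a := g y), ← map_sub, ← map_sub, ← sign_eq_one_iff, hfg,
      sign_eq_one_iff]
  by_contra! hcon
  choose! w hw using hcon
  have hn : q.natDegree ≠ 0 := by
    intro h0
    rw [hq.natDegree_eq_zero.1 h0] at hα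
    simp at hα
  have hqf : q.map f ≠ 0 := (hq.map f).ne_zero
  have hqg : q.map g ≠ 0 := (hq.map g).ne_zero
  have hder : q.derivative ≠ 0 := by
    intro h
    have h1 : (q.map f).derivative = 0 := by rw [Polynomial.derivative_map, h, Polynomial.map_zero]
    have := Polynomial.derivative_eq_zero.1 h1
    rw [hq.natDegree_map] at this
    exact hn this
  let W : Finset Γ := q.derivative.roots.toFinset ∪ (q.map g).roots.toFinset.image w
  obtain ⟨M, hM⟩ := exists_gt_root hq hα
  rw [abs_lt] at hM
  obtain ⟨u, hu, hmax⟩ := Finset.exists_max_image ((insert (-M) W).filter (f · < α)) f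
    ⟨-M, by simp [hM.1]⟩
  obtain ⟨v, hv, hmin⟩ := Finset.exists_min_image ((insert M W).filter (α < f ·)) f
    ⟨M, by simp [hM.2]⟩
  simp only [Finset.mem_filter, Finset.mem_insert] at hu hv hmax hmin
  have hneg : (q.map f).eval (f u) * (q.map f).eval (f v) < 0 := by
    refine hK.eval_mul_eval_neg hqf hu.2 hv.2 (by rwa [Polynomial.eval_map]) fun c huc hcv hc => ?_
    rw [Polynomial.derivative_map, Polynomial.eval_map] at hc
    obtain ⟨γ, rfl⟩ := hdf _ hder (Polynomial.natDegree_derivative_lt hn) c hc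
    have hγ : γ ∈ W := by
      refine Finset.mem_union_left _ ?_
      rw [Multiset.mem_toFinset, Polynomial.mem_roots hder]
      rw [Polynomial.eval₂_at_apply] at hc
      exact hf (by rw [hc, map_zero])
    rcases (hαf γ).lt_or_gt with h | h
    · exact (hmax γ ⟨Or.inr hγ, h⟩).not_gt huc
    · exact (hmin γ ⟨Or.inr hγ, h⟩).not_gt hcv
  have hneg' : (q.map g).eval (g u) * (q.map g).eval (g v) < 0 := by
    rw [Polynomial.eval_map, Polynomial.eval_map, Polynomial.eval₂_at_apply,
      Polynomial.eval₂_at_apply, ← map_mul, ← sign_eq_neg_one_iff] at hneg ⊢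
    rwa [← hfg]
  obtain ⟨β, huβ, hβv, hβ⟩ := hL _ _ _ ((hlt u v).1 (hu.2.trans hv.2)) hneg'
  have hwW : w β ∈ W := Finset.mem_union_right _ (Finset.mem_image_of_mem _ (by
    rw [Multiset.mem_toFinset, Polynomial.mem_roots hqg]; exact hβ))
  rw [Polynomial.eval_map] at hβ
  apply hw β hβ
  rcases (hαf (w β)).lt_or_gt with h | h
  · have h1 := hmax _ ⟨Or.inr hwW, h⟩
    have h2 : g (w β) < β := lt_of_le_of_lt (not_lt.1 fun h3 => h1.not_gt ((hlt _ _).2 h3)) huβ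
    rw [sign_pos (sub_pos.2 h), sign_pos (sub_pos.2 h2)]
  · have h1 := hmin _ ⟨Or.inr hwW, h⟩
    have h2 : β < g (w β) := lt_of_lt_of_le hβv (not_lt.1 fun h3 => h1.not_gt ((hlt _ _).2 h3))
    rw [sign_neg (sub_neg.2 h), sign_neg (sub_neg.2 h2)]

lemma exists_sign_eval₂_eq_of_root [IsDomain Γ] (hK : HasPolyIVT K) (hL : HasPolyIVT L) {f : Γ →+* K}
    {g : Γ →+* L} (hf : Function.Injective f) (hg : Function.Injective g)
    (hfg : ∀ γ, SignType.sign (f γ) = SignType.sign (g γ)) {q : Polynomial Γ} (hq : q.Monic)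
    (hdf : RootsLift f q.natDegree) (hdg : RootsLift g q.natDegree) {α : K}
    (hα : q.eval₂ f α = 0) (hαf : ∀ γ, f γ ≠ α) :
    ∃ β, ∀ r : Polynomial Γ, SignType.sign (r.eval₂ f α) = SignType.sign (r.eval₂ g β) := by
  obtain ⟨β, hβ, hcut⟩ := exists_root_of_cut hK hL hf hfg hq hdf hα hαf
  refine ⟨β, fun r => ?_⟩
  have hq1 : q ≠ 1 := by rintro rfl; simp at hα
  have := sign_eval₂_eq_of_cut hK hL hf hg hfg hdf hdg hcut (r %ₘ q)
    (Polynomial.natDegree_modByMonic_lt r hq hq1)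
  rw [← Polynomial.modByMonic_add_div r q]
  simpa [Polynomial.eval₂_add, Polynomial.eval₂_mul, hα, hβ] using this

end SignCompat

/-- Countable cuts are realized. -/
def CutSaturated (L : Type*) [LinearOrder L] : Prop :=
  ∀ A B : Set L, A.Countable → B.Countable → (∀ a ∈ A, ∀ b ∈ B, a < b) →
    ∃ x, (∀ a ∈ A, a < x) ∧ ∀ b ∈ B, x < b

section Extension

variable {K L : Type*} [Field K] [LinearOrder K] [IsStrictOrderedRing K] [Field L]
  [LinearOrder L] [IsStrictOrderedRing L]

/-- A subring of `K × L` on which both coordinates have the same sign. -/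
def SignCompat (Γ : Subring (K × L)) : Prop :=
  ∀ x ∈ Γ, SignType.sign x.1 = SignType.sign x.2

omit [IsStrictOrderedRing K] [IsStrictOrderedRing L] in
lemma SignCompat.exists_maximal {Γ₀ : Subring (K × L)} (h : SignCompat Γ₀) :
    ∃ Γ, Γ₀ ≤ Γ ∧ Maximal SignCompat Γ :=
  zorn_le_nonempty₀ {Γ : Subring (K × L) | SignCompat Γ} (by
    intro c hc hchain I hI
    refine ⟨sSup c, fun x hx => ?_, fun J hJ => le_sSup hJ⟩
    obtain ⟨F, hF, hxF⟩ := (Subring.mem_sSup_of_directedOn ⟨I, hI⟩ hchain.directedOn).1 hx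
    exact hc hF x hxF) Γ₀ h

variable (Γ : Subring (K × L))

/-- The first projection. -/
def fstHom : Γ →+* K := (RingHom.fst K L).comp Γ.subtype

/-- The second projection. -/
def sndHom : Γ →+* L := (RingHom.snd K L).comp Γ.subtype

omit [LinearOrder K] [IsStrictOrderedRing K] [LinearOrder L] [IsStrictOrderedRing L] in
lemma fstHom_apply (x : Γ) : fstHom Γ x = x.1.1 := rfl

omit [LinearOrder K] [IsStrictOrderedRing K] [LinearOrder L] [IsStrictOrderedRing L] in
lemma sndHom_apply (x : Γ) : sndHom Γ x = x.1.2 := rfl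

variable {Γ}

omit [IsStrictOrderedRing K] [IsStrictOrderedRing L] in
lemma SignCompat.fstHom_injective (h : SignCompat Γ) : Function.Injective (fstHom Γ) := by
  rw [injective_iff_map_eq_zero]
  intro x hx
  have h1 := h x.1 x.2
  rw [fstHom_apply] at hx
  rw [hx, sign_zero, eq_comm, sign_eq_zero_iff] at h1
  exact Subtype.ext (Prod.ext hx h1)

omit [IsStrictOrderedRing K] [IsStrictOrderedRing L] in
lemma SignCompat.sndHom_injective (h : SignCompat Γ) : Function.Injective (sndHom Γ) := by
  rw [injective_iff_map_eq_zero]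
  intro x hx
  have h1 := h x.1 x.2
  rw [sndHom_apply] at hx
  rw [hx, sign_zero, sign_eq_zero_iff] at h1
  exact Subtype.ext (Prod.ext h1 hx)

omit [IsStrictOrderedRing K] [IsStrictOrderedRing L] in
lemma SignCompat.isDomain (h : SignCompat Γ) : IsDomain Γ :=
  h.fstHom_injective.isDomain (fstHom Γ)

omit [IsStrictOrderedRing K] [IsStrictOrderedRing L] in
lemma mem_of_sign_eval₂_eq (hΓ : Maximal SignCompat Γ) {α : K} {β : L}
    (h : ∀ r : Polynomial Γ, SignType.sign (r.eval₂ (fstHom Γ) α) =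
      SignType.sign (r.eval₂ (sndHom Γ) β)) : (α, β) ∈ Γ := by
  let φ : Polynomial Γ →+* K × L :=
    (Polynomial.eval₂RingHom (fstHom Γ) α).prod (Polynomial.eval₂RingHom (sndHom Γ) β)
  have hle : Γ ≤ φ.range := fun x hx => ⟨Polynomial.C ⟨x, hx⟩, by
    simp [φ, fstHom_apply, sndHom_apply]⟩
  refine hΓ.le_of_ge (y := φ.range) ?_ hle ⟨Polynomial.X, by simp [φ]⟩
  rintro _ ⟨r, rfl⟩
  exact h r

lemma map_sum_coeff_mul_pow_eq {R F : Type*} [CommRing R] [Field F] (f : R →+* F) {x : R}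
    (hx : f x ≠ 0) (r : Polynomial R) :
    f (∑ i ∈ Finset.range (r.natDegree + 1), r.coeff i * x ^ (r.natDegree - i)) =
      r.eval₂ f (f x)⁻¹ * f x ^ r.natDegree := by
  rw [Polynomial.eval₂_eq_sum_range, Finset.sum_mul, map_sum]
  refine Finset.sum_congr rfl fun i hi => ?_
  rw [map_mul, map_pow, pow_sub₀ _ hx (Nat.lt_succ_iff.1 (Finset.mem_range.1 hi)), inv_pow]
  ring

lemma exists_mul_eq_one (hΓ : Maximal SignCompat Γ) {x : Γ} (hx : x ≠ 0) :
    ∃ y : Γ, x * y = 1 := by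
  have hc : SignCompat Γ := hΓ.prop
  have h1 : fstHom Γ x ≠ 0 := (map_ne_zero_iff _ hc.fstHom_injective).2 hx
  have h2 : sndHom Γ x ≠ 0 := (map_ne_zero_iff _ hc.sndHom_injective).2 hx
  have hmem : ((fstHom Γ x)⁻¹, (sndHom Γ x)⁻¹) ∈ Γ := mem_of_sign_eval₂_eq hΓ fun r => by
    have h3 := hc _ (∑ i ∈ Finset.range (r.natDegree + 1),
      r.coeff i * x ^ (r.natDegree - i)).2
    rw [← fstHom_apply, ← sndHom_apply, map_sum_coeff_mul_pow_eq _ h1,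
      map_sum_coeff_mul_pow_eq _ h2, sign_mul, sign_mul] at h3
    have h4 := hc _ (x ^ r.natDegree).2
    rw [← fstHom_apply, ← sndHom_apply, map_pow (fstHom Γ), map_pow (sndHom Γ)] at h4
    rw [h4] at h3
    exact mul_right_cancel₀ (sign_ne_zero.2 (pow_ne_zero _ h2)) h3
  refine ⟨⟨_, hmem⟩, Subtype.ext (Prod.ext ?_ ?_)⟩
  · exact mul_inv_cancel₀ h1
  · exact mul_inv_cancel₀ h2

lemma exists_monic (hΓ : Maximal SignCompat Γ) {q : Polynomial Γ} (hq : q ≠ 0) :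
    ∃ q' : Polynomial Γ, q'.Monic ∧ q'.natDegree = q.natDegree ∧ ∃ y, q' = Polynomial.C y * q := by
  have hc : SignCompat Γ := hΓ.prop
  have := hc.isDomain
  obtain ⟨y, hy⟩ := exists_mul_eq_one hΓ (Polynomial.leadingCoeff_ne_zero.2 hq)
  have hy0 : y ≠ 0 := right_ne_zero_of_mul_eq_one hy
  refine ⟨_, ?_, Polynomial.natDegree_C_mul hy0, y, rfl⟩
  rw [Polynomial.Monic, Polynomial.leadingCoeff_mul, Polynomial.leadingCoeff_C, mul_comm, hy]

lemma rootsLift_of_maximal (hK : HasPolyIVT K) (hL : HasPolyIVT L) (hΓ : Maximal SignCompat Γ)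
    (d : ℕ) : RootsLift (fstHom Γ) d ∧ RootsLift (sndHom Γ) d := by
  have hc : SignCompat Γ := hΓ.prop
  have := hc.isDomain
  have hfi := hc.fstHom_injective
  have hgi := hc.sndHom_injective
  have hfg (γ : Γ) : SignType.sign (fstHom Γ γ) = SignType.sign (sndHom Γ γ) := hc _ γ.2
  induction d with
  | zero => exact ⟨fun q _ h => absurd h (by omega), fun q _ h => absurd h (by omega)⟩
  | succ d ih =>
    refine ⟨fun q hq hd x hx => ?_, fun q hq hd x hx => ?_⟩
    · rcases (Nat.lt_succ_iff.1 hd).lt_or_eq with hd | hd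
      · exact ih.1 q hq hd x hx
      obtain ⟨q', hq', hdq, y, hy⟩ := exists_monic hΓ hq
      by_contra! hcon
      rw [← hd, ← hdq] at ih
      obtain ⟨β, hβ⟩ := exists_sign_eval₂_eq_of_root hK hL hfi hgi hfg hq' ih.1 ih.2
        (by rw [hy, Polynomial.eval₂_mul, hx, mul_zero]) hcon
      exact hcon ⟨_, mem_of_sign_eval₂_eq hΓ hβ⟩ rfl
    · rcases (Nat.lt_succ_iff.1 hd).lt_or_eq with hd | hd
      · exact ih.2 q hq hd x hx
      obtain ⟨q', hq', hdq, y, hy⟩ := exists_monic hΓ hq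
      by_contra! hcon
      rw [← hd, ← hdq] at ih
      obtain ⟨β, hβ⟩ := exists_sign_eval₂_eq_of_root hL hK hgi hfi (fun γ => (hfg γ).symm) hq'
        ih.2 ih.1 (by rw [hy, Polynomial.eval₂_mul, hx, mul_zero]) hcon
      exact hcon ⟨_, mem_of_sign_eval₂_eq hΓ fun r => (hβ r).symm⟩ rfl

/-- A sign-compatible partial correspondence between a countable field `K` and a saturated field
`L`, both with the intermediate value property, extends to all of `K`. -/
theorem SignCompat.exists_extension [Countable K] (hK : HasPolyIVT K) (hL : HasPolyIVT L)
    (hsat : CutSaturated L) {Γ₀ : Subring (K × L)} (h₀ : SignCompat Γ₀) :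
    ∃ Γ, Γ₀ ≤ Γ ∧ SignCompat Γ ∧ ∀ α : K, ∃ β : L, (α, β) ∈ Γ := by
  obtain ⟨Γ, hle, hΓ⟩ := h₀.exists_maximal
  have hc : SignCompat Γ := hΓ.prop
  refine ⟨Γ, hle, hc, fun α => ?_⟩
  by_cases hα : ∃ γ, fstHom Γ γ = α
  · obtain ⟨γ, rfl⟩ := hα
    exact ⟨_, γ.2⟩
  push Not at hα
  have := hc.isDomain
  have hfi := hc.fstHom_injective
  have : Countable Γ := hfi.countable
  have hfg (γ : Γ) : SignType.sign (fstHom Γ γ) = SignType.sign (sndHom Γ γ) := hc _ γ.2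
  obtain ⟨β, hβ₁, hβ₂⟩ := hsat (sndHom Γ '' {γ | fstHom Γ γ < α}) (sndHom Γ '' {γ | α < fstHom Γ γ})
    ((Set.to_countable _).image _) ((Set.to_countable _).image _) (by
      rintro _ ⟨x, hx, rfl⟩ _ ⟨y, hy, rfl⟩
      have hxy : fstHom Γ x < fstHom Γ y := lt_trans hx hy
      rwa [← sub_pos, ← map_sub, ← sign_eq_one_iff, ← hfg, sign_eq_one_iff, map_sub, sub_pos])
  refine ⟨β, mem_of_sign_eval₂_eq hΓ fun r => ?_⟩
  obtain ⟨h1, h2⟩ := rootsLift_of_maximal hK hL hΓ (r.natDegree + 1)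
  refine sign_eval₂_eq_of_cut hK hL hfi hc.sndHom_injective hfg h1 h2 (fun γ => ?_) r
    (Nat.lt_succ_self _)
  rcases (hα γ).lt_or_gt with h | h
  · rw [sign_pos (sub_pos.2 h), sign_pos (sub_pos.2 (hβ₁ _ ⟨γ, h, rfl⟩))]
  · rw [sign_neg (sub_neg.2 h), sign_neg (sub_neg.2 (hβ₂ _ ⟨γ, h, rfl⟩))]

end Extension

section Ultrapower

open Filter

/-- The ultrapower of `ℝ` along a nonprincipal ultrafilter on `ℕ`. -/
abbrev RealUltrapower : Type := Germ (hyperfilter ℕ : Filter ℕ) ℝ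

lemma coe_eval_eq (P : Polynomial (ℕ → ℝ)) (x : ℕ → ℝ) :
    (P.map (Germ.coeRingHom (hyperfilter ℕ : Filter ℕ))).eval (x : RealUltrapower) =
      ((fun k => (P.map (Pi.evalRingHom (fun _ => ℝ) k)).eval (x k) : ℕ → ℝ) :
        RealUltrapower) := by
  have h1 : (P.map (Germ.coeRingHom (hyperfilter ℕ : Filter ℕ))).eval (x : RealUltrapower) =
      Germ.coeRingHom (hyperfilter ℕ : Filter ℕ) (P.eval x) := by
    rw [Polynomial.eval_map, ← Polynomial.eval₂_at_apply]
    rfl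
  rw [h1]
  change ((P.eval x : ℕ → ℝ) : RealUltrapower) = _
  congr 1
  funext k
  rw [Polynomial.eval_map]
  exact (Polynomial.eval₂_at_apply (Pi.evalRingHom (fun _ => ℝ) k) x).symm

lemma hasPolyIVT_realUltrapower : HasPolyIVT RealUltrapower := by
  intro p a b hab hp
  have hsurj : Function.Surjective (Germ.coeRingHom (hyperfilter ℕ : Filter ℕ) (R := ℝ)) :=
    fun x => Quotient.inductionOn' x fun f => ⟨f, rfl⟩
  obtain ⟨P, rfl⟩ := Polynomial.map_surjective _ hsurj p
  obtain ⟨a, rfl⟩ := hsurj a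
  obtain ⟨b, rfl⟩ := hsurj b
  change (a : RealUltrapower) < b at hab
  change (P.map (Germ.coeRingHom (hyperfilter ℕ : Filter ℕ))).eval (a : RealUltrapower) *
    (P.map (Germ.coeRingHom (hyperfilter ℕ : Filter ℕ))).eval (b : RealUltrapower) < 0 at hp
  rw [coe_eval_eq, coe_eval_eq, ← Germ.coe_mul, ← Germ.coe_zero, Germ.coe_lt] at hp
  rw [Germ.coe_lt] at hab
  have hc : ∀ k, ∃ c, a k < b k → (P.map (Pi.evalRingHom (fun _ => ℝ) k)).eval (a k) *
      (P.map (Pi.evalRingHom (fun _ => ℝ) k)).eval (b k) < 0 →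
      a k < c ∧ c < b k ∧ (P.map (Pi.evalRingHom (fun _ => ℝ) k)).eval c = 0 := by
    intro k
    by_cases h : a k < b k ∧ (P.map (Pi.evalRingHom (fun _ => ℝ) k)).eval (a k) *
      (P.map (Pi.evalRingHom (fun _ => ℝ) k)).eval (b k) < 0
    · obtain ⟨hab, h⟩ := h
      have hcont := (P.map (Pi.evalRingHom (fun _ => ℝ) k)).continuous.continuousOn
        (s := Set.Icc (a k) (b k))
      rcases mul_neg_iff.1 h with ⟨h1, h2⟩ | ⟨h1, h2⟩
      · obtain ⟨c, hc, hc0⟩ := intermediate_value_Ioo' hab.le hcont ⟨h2, h1⟩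
        exact ⟨c, fun _ _ => ⟨hc.1, hc.2, hc0⟩⟩
      · obtain ⟨c, hc, hc0⟩ := intermediate_value_Ioo hab.le hcont ⟨h1, h2⟩
        exact ⟨c, fun _ _ => ⟨hc.1, hc.2, hc0⟩⟩
    · exact ⟨0, fun h1 h2 => absurd ⟨h1, h2⟩ h⟩
  choose c hc using hc
  refine ⟨(c : RealUltrapower), ?_, ?_, ?_⟩
  · refine Germ.coe_lt.2 ?_
    filter_upwards [hab, hp] with k h1 h2 using (hc k h1 h2).1
  · refine Germ.coe_lt.2 ?_
    filter_upwards [hab, hp] with k h1 h2 using (hc k h1 h2).2.1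
  · rw [coe_eval_eq, ← Germ.coe_zero]
    refine Germ.coe_eq.2 ?_
    filter_upwards [hab, hp] with k h1 h2 using (hc k h1 h2).2.2

lemma exists_of_eventually_finset {ι : Type*} [Countable ι] {C : ι → ℕ → ℝ → Prop}
    (h : ∀ F : Finset ι, ∀ᶠ k in (hyperfilter ℕ : Filter ℕ), ∃ x, ∀ i ∈ F, C i k x) :
    ∃ x : ℕ → ℝ, ∀ i, ∀ᶠ k in (hyperfilter ℕ : Filter ℕ), C i k (x k) := by
  classical
  obtain ⟨e, he⟩ := exists_injective_nat ι
  have hfin (N : ℕ) : {i | e i ≤ N}.Finite := (Set.finite_Iic N).preimage he.injOn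
  let D (k N : ℕ) : Prop := ∃ x, ∀ i, e i ≤ N → C i k x
  have hx : ∀ k, ∃ x, ∀ N ≤ k, D k N → ∀ i, e i ≤ N → C i k x := by
    intro k
    by_cases hk : ∃ N ≤ k, D k N
    · obtain ⟨N, hN, hD⟩ := hk
      obtain ⟨x, hx⟩ := Nat.findGreatest_spec hN hD
      exact ⟨x, fun M hM hDM i hi => hx i (hi.trans (Nat.le_findGreatest hM hDM))⟩
    · push Not at hk
      exact ⟨0, fun N hN hD => absurd hD (hk N hN)⟩
  choose x hx using hx
  refine ⟨x, fun i => ?_⟩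
  have h1 : ∀ᶠ k in (hyperfilter ℕ : Filter ℕ), e i ≤ k :=
    (eventually_ge_atTop (e i)).filter_mono Nat.hyperfilter_le_atTop
  filter_upwards [h1, h (hfin (e i)).toFinset] with k hk hD
  refine hx k _ hk ?_ i le_rfl
  obtain ⟨y, hy⟩ := hD
  exact ⟨y, fun j hj => hy j (by simpa using hj)⟩

lemma cutSaturated_realUltrapower : CutSaturated RealUltrapower := by
  intro A B hA hB hAB
  have := hA.to_subtype
  have := hB.to_subtype
  have hsurj : ∀ x : RealUltrapower, ∃ f : ℕ → ℝ, (f : RealUltrapower) = x :=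
    fun x => Quotient.inductionOn' x fun f => ⟨f, rfl⟩
  choose r hr using hsurj
  obtain ⟨x, hx⟩ := exists_of_eventually_finset (ι := A ⊕ B)
    (C := fun i k x => i.elim (fun a : A => r a k < x) (fun b : B => x < r b k)) (by
      intro F
      classical
      have : ∀ᶠ k in (hyperfilter ℕ : Filter ℕ), ∀ i ∈ F, ∀ j ∈ F,
          ∀ (a : A) (b : B), i = Sum.inl a → j = Sum.inr b → r a k < r b k := by
        refine (Filter.eventually_all_finset F).2 fun i _ =>
          (Filter.eventually_all_finset F).2 fun j _ => ?_
        rcases i with a | b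
        · rcases j with a' | b'
          · simp
          · have := hAB a a.2 b' b'.2
            rw [← hr a, ← hr b', Germ.coe_lt] at this
            filter_upwards [this] with k hk a₁ b₁ h1 h2
            cases h1
            cases h2
            exact hk
        · simp
      filter_upwards [this] with k hk
      obtain ⟨m, hm1, hm2⟩ := Order.exists_between_finsets
        (F.toLeft.image fun a : A => r a k) (F.toRight.image fun b : B => r b k) (by
          intro x hx y hy
          simp only [Finset.mem_image, Finset.mem_toLeft, Finset.mem_toRight] at hx hy
          obtain ⟨a, ha, rfl⟩ := hx
          obtain ⟨b, hb, rfl⟩ := hy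
          exact hk _ ha _ hb a b rfl rfl)
      refine ⟨m, fun i hi => ?_⟩
      rcases i with a | b
      · exact hm1 _ (Finset.mem_image_of_mem _ (Finset.mem_toLeft.2 hi))
      · exact hm2 _ (Finset.mem_image_of_mem _ (Finset.mem_toRight.2 hi)))
  refine ⟨(x : RealUltrapower), fun a ha => ?_, fun b hb => ?_⟩
  · rw [← hr a]
    exact Germ.coe_lt.2 (hx (Sum.inl ⟨a, ha⟩))
  · rw [← hr b]
    exact Germ.coe_lt.2 (hx (Sum.inr ⟨b, hb⟩))

end Ultrapower

section Preordering

/-- The preordering generated by `s`. -/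
def preord {R : Type*} [CommRing R] (s : Set R) : Subsemiring R :=
  Subsemiring.closure ({x | ∃ p, x = p ^ 2} ∪ s)

variable {R : Type*} [CommRing R]

lemma sq_mem_preord (s : Set R) (p : R) : p ^ 2 ∈ preord s :=
  Subsemiring.subset_closure (Or.inl ⟨p, rfl⟩)

lemma mem_preord_of_mem {s : Set R} {p : R} (hp : p ∈ s) : p ∈ preord s :=
  Subsemiring.subset_closure (Or.inr hp)

lemma exists_eq_add_mul_of_mem_preord_pair {ψ h t : R} (ht : t ∈ preord {ψ, h}) :
    ∃ t₁ ∈ preord {ψ}, ∃ t₂ ∈ preord {ψ}, t = t₁ + h * t₂ := by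
  induction ht using Subsemiring.closure_induction with
  | mem x hx =>
    rcases hx with ⟨p, rfl⟩ | rfl | rfl
    · exact ⟨_, sq_mem_preord _ p, 0, zero_mem _, by simp⟩
    · exact ⟨_, mem_preord_of_mem rfl, 0, zero_mem _, by simp⟩
    · exact ⟨0, zero_mem _, 1, one_mem _, by simp⟩
  | zero => exact ⟨0, zero_mem _, 0, zero_mem _, by simp⟩
  | one => exact ⟨1, one_mem _, 0, zero_mem _, by simp⟩
  | add x y _ _ hx hy =>
    obtain ⟨t₁, h₁, t₂, h₂, rfl⟩ := hx
    obtain ⟨s₁, k₁, s₂, k₂, rfl⟩ := hy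
    exact ⟨_, add_mem h₁ k₁, _, add_mem h₂ k₂, by ring⟩
  | mul x y _ _ hx hy =>
    obtain ⟨t₁, h₁, t₂, h₂, rfl⟩ := hx
    obtain ⟨s₁, k₁, s₂, k₂, rfl⟩ := hy
    exact ⟨_, add_mem (mul_mem h₁ k₁) (mul_mem (sq_mem_preord _ h) (mul_mem h₂ k₂)), _,
      add_mem (mul_mem h₁ k₂) (mul_mem h₂ k₁), by ring⟩

lemma mem_of_mem_preord_singleton {ψ t : R} (ht : t ∈ preord {ψ}) {Q : AddSubmonoid R}
    (h₁ : ∀ p, p ^ 2 ∈ Q) (h₂ : ∀ p, p ^ 2 * ψ ∈ Q) : t ∈ Q := by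
  have hmon : ∀ x ∈ Submonoid.closure ({x | ∃ p, x = p ^ 2} ∪ {ψ}),
      ∃ p, x = p ^ 2 ∨ x = p ^ 2 * ψ := by
    intro x hx
    induction hx using Submonoid.closure_induction with
    | mem x hx =>
      rcases hx with ⟨p, rfl⟩ | rfl
      · exact ⟨p, Or.inl rfl⟩
      · exact ⟨1, Or.inr (by simp)⟩
    | one => exact ⟨1, Or.inl (by simp)⟩
    | mul x y _ _ hx hy =>
      obtain ⟨p, rfl | rfl⟩ := hx <;> obtain ⟨q, rfl | rfl⟩ := hy
      · exact ⟨p * q, Or.inl (by ring)⟩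
      · exact ⟨p * q, Or.inr (by ring)⟩
      · exact ⟨p * q, Or.inr (by ring)⟩
      · exact ⟨p * q * ψ, Or.inl (by ring)⟩
  rw [preord, Subsemiring.mem_closure_iff] at ht
  refine (AddSubmonoid.closure_le.2 fun x hx => ?_) ht
  obtain ⟨p, rfl | rfl⟩ := hmon x hx
  exacts [h₁ p, h₂ p]

end Preordering

section Certificate

variable {n : ℕ}

lemma C_mem_preord (s : Set (MvPolynomial (Fin n) ℝ)) {r : ℝ} (hr : 0 ≤ r) :
    (C r : MvPolynomial (Fin n) ℝ) ∈ preord s := by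
  have := sq_mem_preord s (C (√r))
  rwa [← C_pow, Real.sq_sqrt hr] at this

/-- The substitution of the coefficients `coeff α ψ` for generic coefficients. -/
noncomputable def specialize (ψ : MvPolynomial (Fin n) ℝ) :
    MvPolynomial (ψ.support ⊕ Fin n) ℤ →+* MvPolynomial (Fin n) ℝ :=
  eval₂Hom (Int.castRingHom _) (Sum.elim (fun α => C (ψ.coeff α.1)) X)

/-- The value of an integer polynomial at the coefficients of `ψ`. -/
noncomputable def coeffValue (ψ : MvPolynomial (Fin n) ℝ) : MvPolynomial ψ.support ℤ →+* ℝ :=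
  eval₂Hom (Int.castRingHom _) (fun α => ψ.coeff α.1)

lemma specialize_rename_inl (ψ : MvPolynomial (Fin n) ℝ) (q : MvPolynomial ψ.support ℤ) :
    specialize ψ (rename Sum.inl q) = C (coeffValue ψ q) := by
  have : (specialize ψ).comp (rename Sum.inl : MvPolynomial ψ.support ℤ →ₐ[ℤ] _).toRingHom =
      (C : ℝ →+* MvPolynomial (Fin n) ℝ).comp (coeffValue ψ) := by
    refine MvPolynomial.ringHom_ext (fun r => by simp) fun α => ?_
    simp [specialize, coeffValue]
  exact congrArg (fun f => f q) this

instance {σ : Type} [Countable σ] : Countable (MvPolynomial σ ℤ) := by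
  rw [← Cardinal.mk_le_aleph0_iff]
  refine MvPolynomial.cardinalMk_le_max.trans (max_le (max_le ?_ ?_) le_rfl)
  · exact Cardinal.mk_le_aleph0
  · exact Cardinal.mk_le_aleph0

/-- The diagonal embedding of `ℝ` in its ultrapower. -/
noncomputable def constHom : ℝ →+* RealUltrapower :=
  (Filter.Germ.coeRingHom _).comp (Pi.constRingHom ℕ ℝ)

lemma sign_constHom (x : ℝ) : SignType.sign (constHom x) = SignType.sign x := by
  have h (y : ℝ) (hy : 0 < y) : 0 < constHom y :=
    Filter.Germ.coe_lt.2 (Filter.Eventually.of_forall fun _ => hy)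
  rcases lt_trichotomy x 0 with hx | rfl | hx
  · rw [sign_neg hx, sign_neg]
    have := h (-x) (neg_pos.2 hx)
    rwa [map_neg, neg_pos] at this
  · rw [map_zero, sign_zero, sign_zero]
  · rw [sign_pos hx, sign_pos (h x hx)]

/-- A Positivstellensatz certificate for boundedness of `{ψ ≥ 0}`. -/
theorem neg_one_mem_preord_of_bounded (ψ : MvPolynomial (Fin n) ℝ) (N : ℕ)
    (hN : ∀ y : Fin n → ℝ, 0 ≤ eval y ψ → ∑ i, y i ^ 2 < N) :
    (-1 : MvPolynomial (Fin n) ℝ) ∈ preord {ψ, ∑ i, X i ^ 2 - C (N : ℝ)} := by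
  by_contra hcon
  set T := preord {ψ, ∑ i, X i ^ 2 - C (N : ℝ)} with hT
  obtain ⟨E, _, _, _, ρ, hE, hρ, _⟩ := exists_hom_to_polyIVT_field (T := T.comap (specialize ψ))
    (fun b => by rw [Subsemiring.mem_comap, map_pow]; exact sq_mem_preord _ _)
    (by rwa [Subsemiring.mem_comap, map_neg, map_one])
  let ι : MvPolynomial ψ.support ℤ →+* MvPolynomial (ψ.support ⊕ Fin n) ℤ :=
    (rename Sum.inl : MvPolynomial ψ.support ℤ →ₐ[ℤ] _).toRingHom
  have hι (q) (hq : 0 ≤ coeffValue ψ q) : 0 ≤ ρ (ι q) := hρ _ (by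
    rw [Subsemiring.mem_comap]
    change specialize ψ (rename Sum.inl q) ∈ T
    rw [specialize_rename_inl]
    exact C_mem_preord _ hq)
  have hι' (q) (hq : 0 < coeffValue ψ q) : 0 < ρ (ι q) := by
    obtain ⟨m, hm⟩ := exists_nat_gt (coeffValue ψ q)⁻¹
    have h1 : 0 ≤ coeffValue ψ (m * q - 1) := by
      rw [map_sub, map_mul, map_natCast, map_one, sub_nonneg]
      rw [inv_lt_iff_one_lt_mul₀ hq] at hm
      linarith
    have h2 := hι _ h1
    rw [map_sub, map_mul, map_natCast, map_one, map_sub, map_mul, map_natCast, map_one] at h2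
    have h3 : (0 : E) ≤ m := Nat.cast_nonneg m
    by_contra! h4
    nlinarith
  let Γ₀ : Subring (E × RealUltrapower) := ((ρ.comp ι).prod (constHom.comp (coeffValue ψ))).range
  have hΓ₀ : SignCompat Γ₀ := by
    rintro _ ⟨q, rfl⟩
    change SignType.sign (ρ (ι q)) = SignType.sign (constHom (coeffValue ψ q))
    rw [sign_constHom]
    rcases lt_trichotomy (coeffValue ψ q) 0 with hq | hq | hq
    · have := hι' (-q) (by rwa [map_neg, neg_pos])
      rw [map_neg, map_neg, neg_pos] at this
      rw [sign_neg hq, sign_neg this]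
    · have h1 := hι q hq.ge
      have h2 := hι (-q) (by rw [map_neg, hq, neg_zero])
      rw [map_neg, map_neg, neg_nonneg] at h2
      rw [hq, le_antisymm h2 h1, sign_zero, sign_zero]
    · rw [sign_pos hq, sign_pos (hι' q hq)]
  obtain ⟨Γ, hle, hΓ, hsurj⟩ := hΓ₀.exists_extension hE hasPolyIVT_realUltrapower
    cutSaturated_realUltrapower
  have hw : ∀ i : Fin n, ∃ u : ℕ → ℝ, (ρ (X (Sum.inr i)), (u : RealUltrapower)) ∈ Γ := by
    intro i
    obtain ⟨w, hw⟩ := hsurj (ρ (X (Sum.inr i)))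
    induction w using Filter.Germ.inductionOn with
    | _ u => exact ⟨u, hw⟩
  choose u hu using hw
  let W : MvPolynomial (ψ.support ⊕ Fin n) ℤ →+* RealUltrapower :=
    (Filter.Germ.coeRingHom _).comp
      (RingHom.pi fun k => (eval fun i => u i k).comp (specialize ψ))
  have hmem (b) : (ρ b, W b) ∈ Γ := by
    induction b using MvPolynomial.induction_on with
    | C m =>
      have : (ρ (C m), W (C m)) = ((m : ℤ) : E × RealUltrapower) := by
        have h1 : (C m : MvPolynomial (ψ.support ⊕ Fin n) ℤ) = (m : ℤ) := by simp
        rw [h1, map_intCast, map_intCast]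
        rfl
      rw [this]
      exact intCast_mem _ _
    | add p q hp hq => simpa using add_mem hp hq
    | mul_X p i hp =>
      have : (ρ (X i), W (X i)) ∈ Γ := by
        rcases i with α | i
        · refine hle ⟨X α, ?_⟩
          refine Prod.ext ?_ ?_
          · change ρ (rename Sum.inl (X α)) = ρ (X (Sum.inl α))
            rw [rename_X]
          · change constHom (coeffValue ψ (X α)) = W (X (Sum.inl α))
            change ((fun _ => coeffValue ψ (X α) : ℕ → ℝ) : RealUltrapower) =
              ((fun k => eval (fun i => u i k) (specialize ψ (X (Sum.inl α)))) : ℕ → ℝ)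
            congr 1
            funext k
            simp [coeffValue, specialize]
        · convert hu i using 2
          change ((fun k => eval (fun i => u i k) (specialize ψ (X (Sum.inr i)))) : ℕ → ℝ) =
            (u i : RealUltrapower)
          congr 1
          funext k
          simp [specialize]
      simpa using mul_mem hp this
  have hev (b) (hb : specialize ψ b ∈ T) :
      ∀ᶠ k in (Filter.hyperfilter ℕ : Filter ℕ), 0 ≤ eval (fun i => u i k) (specialize ψ b) := by
    have h1 := hΓ _ (hmem b)
    have h2 : 0 ≤ W b := by
      rw [← sign_nonneg_iff, ← h1, sign_nonneg_iff]
      exact hρ b hb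
    exact Filter.Germ.coe_le.1 h2
  have hψ : specialize ψ (∑ α : ψ.support, X (Sum.inl α) * ∏ i, X (Sum.inr i) ^ α.1 i) = ψ := by
    simp only [specialize, map_sum, map_mul, map_prod, map_pow, coe_eval₂Hom, eval₂_X,
      Sum.elim_inl, Sum.elim_inr]
    conv_rhs => rw [ψ.as_sum, ← Finset.sum_coe_sort]
    refine Finset.sum_congr rfl fun α _ => ?_
    rw [monomial_eq, Finsupp.prod_fintype _ _ (by simp)]
  have hh : specialize ψ (∑ i, X (Sum.inr i) ^ 2 - (N : MvPolynomial (ψ.support ⊕ Fin n) ℤ)) = ∑ i, X i ^ 2 - C (N : ℝ) := by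
    simp [specialize]
  have e1 := hev _ (by rw [hψ]; exact mem_preord_of_mem (by simp))
  have e2 := hev _ (by rw [hh]; exact mem_preord_of_mem (by simp))
  rw [hψ] at e1
  rw [hh] at e2
  obtain ⟨k, h1, h2⟩ := (e1.and e2).exists
  have := hN _ h1
  simp only [map_sub, map_sum, map_pow, eval_X, eval_C] at h2
  linarith

end Certificate

section Bounded

variable {n : ℕ}

/-- If `Q` bounds `∑ i, X i ^ 2`, it bounds every polynomial. -/
lemma exists_C_sub_mem {Q : AddSubmonoid (MvPolynomial (Fin n) ℝ)} (h₁ : ∀ p, p ^ 2 ∈ Q)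
    (h₂ : ∀ p, ∀ x ∈ Q, p ^ 2 * x ∈ Q) {N : ℝ} (hN : C N - ∑ i, X i ^ 2 ∈ Q)
    (p : MvPolynomial (Fin n) ℝ) : ∃ c : ℝ, C c - p ∈ Q := by
  have hC {r : ℝ} (hr : 0 ≤ r) : (C r : MvPolynomial (Fin n) ℝ) ∈ Q := by
    have := h₁ (C (√r))
    rwa [← C_pow, Real.sq_sqrt hr] at this
  have hCmul {r : ℝ} (hr : 0 ≤ r) {x : MvPolynomial (Fin n) ℝ} (hx : x ∈ Q) : C r * x ∈ Q := by
    have := h₂ (C (√r)) x hx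
    rwa [← C_pow, Real.sq_sqrt hr] at this
  have hsq : ∃ c : ℝ, 0 ≤ c ∧ C c - p ^ 2 ∈ Q := by
    have pos {q : MvPolynomial (Fin n) ℝ} (hq : ∃ c : ℝ, C c - q ^ 2 ∈ Q) :
        ∃ c : ℝ, 0 ≤ c ∧ C c - q ^ 2 ∈ Q := by
      obtain ⟨c, hc⟩ := hq
      refine ⟨c ^ 2 + 1, by positivity, ?_⟩
      have h3 : (C (c ^ 2 + 1) - q ^ 2 : MvPolynomial (Fin n) ℝ) =
        C (c ^ 2 + 1 - c) + (C c - q ^ 2) := by rw [C_sub]; ring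
      rw [h3]
      exact add_mem (hC (by nlinarith [sq_nonneg (c - 1)])) hc
    induction p using MvPolynomial.induction_on with
    | C r => exact ⟨r ^ 2, sq_nonneg r, by rw [← C_pow, sub_self]; exact zero_mem _⟩
    | add p q hp hq =>
      obtain ⟨c, hc, hp⟩ := hp
      obtain ⟨d, hd, hq⟩ := hq
      refine ⟨2 * (c + d), by positivity, ?_⟩
      have : (C (2 * (c + d)) - (p + q) ^ 2 : MvPolynomial (Fin n) ℝ) =
          ((C c - p ^ 2) + (C c - p ^ 2)) + ((C d - q ^ 2) + (C d - q ^ 2)) + (p - q) ^ 2 := by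
        rw [C_mul, C_add, show (C 2 : MvPolynomial (Fin n) ℝ) = 2 from rfl]
        ring
      rw [this]
      exact add_mem (add_mem (add_mem hp hp) (add_mem hq hq)) (h₁ _)
    | mul_X p i hp =>
      obtain ⟨c, hc, hp⟩ := hp
      obtain ⟨d, hd, hX⟩ : ∃ d : ℝ, 0 ≤ d ∧ C d - X i ^ 2 ∈ Q := pos ⟨N, by
        have : (C N - X i ^ 2 : MvPolynomial (Fin n) ℝ) =
            (C N - ∑ i, X i ^ 2) + ∑ j ∈ Finset.univ.erase i, X j ^ 2 := by
          rw [← Finset.add_sum_erase _ _ (Finset.mem_univ i)]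
          ring
        rw [this]
        exact add_mem hN (sum_mem fun j _ => h₁ _)⟩
      refine ⟨d * c, by positivity, ?_⟩
      have : (C (d * c) - (p * X i) ^ 2 : MvPolynomial (Fin n) ℝ) =
          C d * (C c - p ^ 2) + p ^ 2 * (C d - X i ^ 2) := by
        rw [C_mul]
        ring
      rw [this]
      exact add_mem (hCmul hd hp) (h₂ _ _ hX)
  obtain ⟨c, -, hc⟩ := hsq
  refine ⟨(1 + c) / 2, ?_⟩
  have : (C ((1 + c) / 2) - p : MvPolynomial (Fin n) ℝ) =
      C (1 / 2) * (1 - p) ^ 2 + C (1 / 2) * (C c - p ^ 2) := by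
    have h3 : (C ((1 + c) / 2) : MvPolynomial (Fin n) ℝ) = C (1 / 2) * (1 + C c) := by
      rw [← C_1, ← C_add, ← C_mul]
      congr 1
      ring
    have h4 : (C (1 / 2) * 2 : MvPolynomial (Fin n) ℝ) = 1 := by
      rw [show (2 : MvPolynomial (Fin n) ℝ) = C 2 from rfl, ← C_mul, ← C_1]
      norm_num
    rw [h3]
    linear_combination p * h4
  rw [this]
  exact add_mem (hCmul (by norm_num) (h₁ _)) (hCmul (by norm_num) hc)

/-- If `{ψ ≥ 0}` is compact, the preordering of `ψ` bounds `∑ i, X i ^ 2`. -/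
theorem exists_C_sub_mem_preord {ψ : MvPolynomial (Fin n) ℝ}
    (hψ : IsCompact {y : Fin n → ℝ | 0 ≤ eval y ψ}) :
    ∃ N : ℝ, C N - ∑ i, X i ^ 2 ∈ preord {ψ} := by
  obtain ⟨N, hN⟩ : ∃ N : ℕ, ∀ y : Fin n → ℝ, 0 ≤ eval y ψ → ∑ i, y i ^ 2 < N := by
    obtain ⟨M, hM⟩ := (hψ.bddAbove_image (f := fun y => ∑ i, y i ^ 2)
      (by fun_prop : Continuous _).continuousOn)
    obtain ⟨N, hN⟩ := exists_nat_gt M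
    exact ⟨N, fun y hy => (hM ⟨y, hy, rfl⟩).trans_lt hN⟩
  set S : MvPolynomial (Fin n) ℝ := ∑ i, X i ^ 2 with hS
  obtain ⟨q, hq, p, hp, hpq⟩ := exists_eq_add_mul_of_mem_preord_pair
    (neg_one_mem_preord_of_bounded ψ N hN)
  rw [← hS] at hpq
  set f : MvPolynomial (Fin n) ℝ := C (N : ℝ) - S with hf
  have hfp : (1 + q) = f * p := by rw [hf]; linear_combination -hpq
  obtain ⟨c, hc⟩ := exists_C_sub_mem (Q := (preord {ψ, f}).toAddSubmonoid)
    (fun p => sq_mem_preord _ p) (fun p x hx => (preord {ψ, f}).mul_mem (sq_mem_preord _ p) hx) (N := N)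
    (mem_preord_of_mem (by simp [hf, hS])) q
  obtain ⟨t₁, ht₁, t₂, ht₂, ht⟩ := exists_eq_add_mul_of_mem_preord_pair hc
  have hq' : C (c + c ^ 2 / 4) - q ∈ preord {ψ} := by
    have h4 : (C (c + c ^ 2 / 4) : MvPolynomial (Fin n) ℝ) = C c + C (c / 2) ^ 2 := by
      rw [← C_pow, ← C_add]
      congr 1
      ring
    have h2 : (C (c / 2) * 2 : MvPolynomial (Fin n) ℝ) = C c := by
      rw [show (2 : MvPolynomial (Fin n) ℝ) = C 2 from rfl, ← C_mul]
      congr 1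
      ring
    have : C (c + c ^ 2 / 4) - q =
        ((1 + q) * t₁ + f ^ 2 * (p * t₂)) + (C (c / 2) - q) ^ 2 := by
      rw [h4]
      linear_combination (1 + q) * ht + (f * t₂) * hfp + q * h2
    rw [this]
    exact add_mem (add_mem (mul_mem (add_mem (one_mem _) hq) ht₁)
      (mul_mem (sq_mem_preord _ _) (mul_mem hp ht₂))) (sq_mem_preord _ _)
  refine ⟨N + N * (c + c ^ 2 / 4), ?_⟩
  have : C (N + N * (c + c ^ 2 / 4)) - S =
      (f ^ 2 * p + q * S) + C (N : ℝ) * (C (c + c ^ 2 / 4) - q) := by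
    rw [C_add, C_mul]
    linear_combination f * hfp
  rw [this]
  refine add_mem (add_mem (mul_mem (sq_mem_preord _ _) hp) (mul_mem hq ?_))
    (mul_mem (C_mem_preord _ (Nat.cast_nonneg N)) hq')
  exact sum_mem fun i _ => sq_mem_preord _ _

end Bounded

section QuadModule

variable {n : ℕ}

/-- Closure under multiplication by squares, and containing the squares. -/
structure IsQuadModule (M : AddSubmonoid (MvPolynomial (Fin n) ℝ)) : Prop where
  sq_mem : ∀ p, p ^ 2 ∈ M
  sq_mul_mem : ∀ p, ∀ x ∈ M, p ^ 2 * x ∈ M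

/-- The sums of squares. -/
noncomputable def sosCone (n : ℕ) : AddSubmonoid (MvPolynomial (Fin n) ℝ) :=
  AddSubmonoid.closure {x | ∃ p, x = p ^ 2}

variable {M : AddSubmonoid (MvPolynomial (Fin n) ℝ)}

lemma isQuadModule_sosCone : IsQuadModule (sosCone n) where
  sq_mem p := AddSubmonoid.subset_closure ⟨p, rfl⟩
  sq_mul_mem p x hx := by
    induction hx using AddSubmonoid.closure_induction with
    | mem x hx =>
      obtain ⟨q, rfl⟩ := hx
      exact AddSubmonoid.subset_closure ⟨p * q, by ring⟩
    | zero => simp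
    | add x y _ _ hx hy => rw [mul_add]; exact add_mem hx hy

namespace IsQuadModule

lemma sosCone_mul_mem (hM : IsQuadModule M) {σ x : MvPolynomial (Fin n) ℝ} (hσ : σ ∈ sosCone n)
    (hx : x ∈ M) : σ * x ∈ M := by
  induction hσ using AddSubmonoid.closure_induction with
  | mem σ hσ =>
    obtain ⟨q, rfl⟩ := hσ
    exact hM.sq_mul_mem _ _ hx
  | zero => simp
  | add σ τ _ _ hσ hτ => rw [add_mul]; exact add_mem hσ hτ

lemma sosCone_le (hM : IsQuadModule M) : sosCone n ≤ M :=
  AddSubmonoid.closure_le.2 fun _ ⟨p, hp⟩ => hp ▸ hM.sq_mem p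

lemma C_mul_mem (hM : IsQuadModule M) {r : ℝ} (hr : 0 ≤ r) {x : MvPolynomial (Fin n) ℝ}
    (hx : x ∈ M) : C r * x ∈ M := by
  have := hM.sq_mul_mem (C (√r)) x hx
  rwa [← C_pow, Real.sq_sqrt hr] at this

lemma C_mem (hM : IsQuadModule M) {r : ℝ} (hr : 0 ≤ r) :
    (C r : MvPolynomial (Fin n) ℝ) ∈ M := by
  have := hM.sq_mem (C (√r))
  rwa [← C_pow, Real.sq_sqrt hr] at this

lemma mul_mem_of_neg_mem (hM : IsQuadModule M) {x : MvPolynomial (Fin n) ℝ} (hx : x ∈ M)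
    (hnx : -x ∈ M) (y : MvPolynomial (Fin n) ℝ) : y * x ∈ M := by
  have h : (C (1 / 2) * 2 : MvPolynomial (Fin n) ℝ) = 1 := by
    rw [show (2 : MvPolynomial (Fin n) ℝ) = C 2 from rfl, ← C_mul, ← C_1]
    norm_num
  have : y * x = (C (1 / 2) * (y + 1)) ^ 2 * x + (C (1 / 2) * (y - 1)) ^ 2 * -x := by
    linear_combination (-y * x * (C (1 / 2) * 2 + 1)) * h
  rw [this]
  exact add_mem (hM.sq_mul_mem _ _ hx) (hM.sq_mul_mem _ _ hnx)

lemma C_mem_iff (hM : IsQuadModule M) (h1 : (-1 : MvPolynomial (Fin n) ℝ) ∉ M) {r : ℝ} :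
    (C r : MvPolynomial (Fin n) ℝ) ∈ M ↔ 0 ≤ r := by
  refine ⟨fun h => ?_, hM.C_mem⟩
  by_contra! hr
  apply h1
  have := hM.C_mul_mem (r := (-r)⁻¹) (inv_nonneg.2 (neg_nonneg.2 hr.le)) h
  rwa [← C_mul, show (-r)⁻¹ * r = -1 by rw [inv_neg, neg_mul, inv_mul_cancel₀ hr.ne], C_neg, C_1] at this

/-- The quadratic module generated by `M` and `a`. -/
lemma sup_map (hM : IsQuadModule M) (a : MvPolynomial (Fin n) ℝ) :
    IsQuadModule (M ⊔ (sosCone n).map (AddMonoidHom.mulRight a)) where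
  sq_mem p := AddSubmonoid.mem_sup_left (hM.sq_mem p)
  sq_mul_mem p x hx := by
    obtain ⟨m, hm, z, ⟨σ, hσ, rfl⟩, rfl⟩ := AddSubmonoid.mem_sup.1 hx
    rw [mul_add]
    refine add_mem (AddSubmonoid.mem_sup_left (hM.sq_mul_mem _ _ hm)) ?_
    refine AddSubmonoid.mem_sup_right ⟨p ^ 2 * σ, isQuadModule_sosCone.sq_mul_mem _ _ hσ, ?_⟩
    simp [mul_assoc]

lemma exists_maximal (hM : IsQuadModule M) (h1 : (-1 : MvPolynomial (Fin n) ℝ) ∉ M) :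
    ∃ M', M ≤ M' ∧ Maximal
      (fun M : AddSubmonoid (MvPolynomial (Fin n) ℝ) => IsQuadModule M ∧ -1 ∉ M) M' :=
  zorn_le_nonempty₀ {M : AddSubmonoid (MvPolynomial (Fin n) ℝ) | IsQuadModule M ∧ -1 ∉ M} (by
    intro c hc hchain I hI
    refine ⟨sSup c, ⟨⟨fun p => ?_, fun p x hx => ?_⟩, fun hmem => ?_⟩, fun J hJ => le_sSup hJ⟩
    · exact (le_sSup hI : I ≤ sSup c) ((hc hI).1.sq_mem p)
    · obtain ⟨F, hF, hxF⟩ := (AddSubmonoid.mem_sSup_of_directedOn ⟨I, hI⟩ hchain.directedOn).1 hx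
      exact (le_sSup hF : F ≤ sSup c) ((hc hF).1.sq_mul_mem p x hxF)
    · obtain ⟨F, hF, hxF⟩ :=
        (AddSubmonoid.mem_sSup_of_directedOn ⟨I, hI⟩ hchain.directedOn).1 hmem
      exact (hc hF).2 hxF) M ⟨hM, h1⟩

lemma mem_or_neg_mem (hM : Maximal
    (fun M : AddSubmonoid (MvPolynomial (Fin n) ℝ) => IsQuadModule M ∧ -1 ∉ M) M)
    (a : MvPolynomial (Fin n) ℝ) : a ∈ M ∨ -a ∈ M := by
  obtain ⟨hQ, h1⟩ := hM.prop
  have key (b : MvPolynomial (Fin n) ℝ) (hb : b ∉ M) :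
      ∃ m ∈ M, ∃ σ ∈ sosCone n, -1 = m + σ * b := by
    by_contra! hcon
    refine hb (hM.le_of_ge (y := M ⊔ (sosCone n).map (AddMonoidHom.mulRight b))
      ⟨hQ.sup_map b, fun h => ?_⟩ le_sup_left (AddSubmonoid.mem_sup_right
        ⟨1, by simpa using isQuadModule_sosCone.sq_mem (1 : MvPolynomial (Fin n) ℝ), by simp⟩))
    obtain ⟨m, hm, z, ⟨σ, hσ, rfl⟩, h⟩ := AddSubmonoid.mem_sup.1 h
    exact hcon m hm σ hσ (by simpa using h.symm)
  by_contra! hcon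
  obtain ⟨s, hs, σ, hσ, h2⟩ := key a hcon.1
  obtain ⟨t, ht, τ, hτ, h3⟩ := key (-a) hcon.2
  have hσM : -σ ∈ M := by
    have : -σ = τ + (σ * t + τ * s) := by linear_combination σ * h3 + τ * h2
    rw [this]
    exact add_mem (hQ.sosCone_le hτ) (add_mem (hQ.sosCone_mul_mem hσ ht)
      (hQ.sosCone_mul_mem hτ hs))
  refine h1 (h2 ▸ add_mem hs ?_)
  rw [mul_comm]
  exact hQ.mul_mem_of_neg_mem (hQ.sosCone_le hσ) hσM a

lemma C_sq_sub_sq_mem (hM : IsQuadModule M) {p : MvPolynomial (Fin n) ℝ} {ε : ℝ} (hε : 0 < ε)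
    (h₁ : C ε - p ∈ M) (h₂ : C ε + p ∈ M) : C (ε ^ 2) - p ^ 2 ∈ M := by
  have h : C (1 / (2 * ε)) * (2 * C ε) = (1 : MvPolynomial (Fin n) ℝ) := by
    rw [show (2 : MvPolynomial (Fin n) ℝ) = C 2 from rfl, ← C_mul, ← C_mul, ← C_1]
    congr 1
    field_simp
  have : C (ε ^ 2) - p ^ 2 =
      C (1 / (2 * ε)) * ((C ε - p) ^ 2 * (C ε + p) + (C ε + p) ^ 2 * (C ε - p)) := by
    rw [C_pow]
    linear_combination (-(C ε ^ 2 - p ^ 2)) * h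
  rw [this]
  exact hM.C_mul_mem (by positivity) (add_mem (hM.sq_mul_mem _ _ h₂) (hM.sq_mul_mem _ _ h₁))

lemma C_sub_mem (hM : IsQuadModule M) {p : MvPolynomial (Fin n) ℝ} {ε : ℝ} (hε : 0 < ε)
    (h : C (ε ^ 2) - p ^ 2 ∈ M) : C ε - p ∈ M := by
  have h2 : C (1 / (2 * ε)) * (2 * C ε) = (1 : MvPolynomial (Fin n) ℝ) := by
    rw [show (2 : MvPolynomial (Fin n) ℝ) = C 2 from rfl, ← C_mul, ← C_mul, ← C_1]
    congr 1
    field_simp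
  have : C ε - p = C (1 / (2 * ε)) * ((C ε - p) ^ 2 + (C (ε ^ 2) - p ^ 2)) := by
    rw [C_pow]
    linear_combination (-(C ε - p)) * h2
  rw [this]
  exact hM.C_mul_mem (by positivity) (add_mem (hM.sq_mem _) h)

/-- The ideal of infinitesimal elements of an Archimedean quadratic module. -/
def infinitesimals (hM : IsQuadModule M)
    (harch : ∀ p : MvPolynomial (Fin n) ℝ, ∃ c : ℝ, C c - p ∈ M) :
    Ideal (MvPolynomial (Fin n) ℝ) where
  carrier := {p | ∀ ε : ℝ, 0 < ε → C ε - p ^ 2 ∈ M}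
  zero_mem' ε hε := by simpa using hM.C_mem hε.le
  add_mem' {p q} hp hq ε hε := by
    have : C ε - (p + q) ^ 2 = ((C (ε / 4) - p ^ 2) + (C (ε / 4) - p ^ 2)) +
        ((C (ε / 4) - q ^ 2) + (C (ε / 4) - q ^ 2)) + (p - q) ^ 2 := by
      have : (C ε : MvPolynomial (Fin n) ℝ) = 4 * C (ε / 4) := by
        rw [show (4 : MvPolynomial (Fin n) ℝ) = C 4 from rfl, ← C_mul]
        congr 1
        ring
      rw [this]
      ring
    rw [this]
    have h4 : 0 < ε / 4 := by positivity
    exact add_mem (add_mem (add_mem (hp _ h4) (hp _ h4)) (add_mem (hq _ h4) (hq _ h4)))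
      (hM.sq_mem _)
  smul_mem' q p hp ε hε := by
    obtain ⟨c, hc⟩ := harch (q ^ 2)
    have hc' : C (c ^ 2 + 1) - q ^ 2 ∈ M := by
      have : (C (c ^ 2 + 1) - q ^ 2 : MvPolynomial (Fin n) ℝ) =
        C (c ^ 2 + 1 - c) + (C c - q ^ 2) := by rw [C_sub]; ring
      rw [this]
      exact add_mem (hM.C_mem (by nlinarith [sq_nonneg (c - 1)])) hc
    have hpos : 0 < c ^ 2 + 1 := by positivity
    have : C ε - (q * p) ^ 2 = p ^ 2 * (C (c ^ 2 + 1) - q ^ 2) +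
        C (c ^ 2 + 1) * (C (ε / (c ^ 2 + 1)) - p ^ 2) := by
      have : (C ε : MvPolynomial (Fin n) ℝ) = C (c ^ 2 + 1) * C (ε / (c ^ 2 + 1)) := by
        rw [← C_mul]
        congr 1
        field_simp
      rw [this]
      ring
    rw [smul_eq_mul, this]
    exact add_mem (hM.sq_mul_mem _ _ hc') (hM.C_mul_mem hpos.le (hp _ (by positivity)))

/-- A maximal proper Archimedean quadratic module is nonnegative at some point. -/
theorem exists_point (hM : Maximal
    (fun M : AddSubmonoid (MvPolynomial (Fin n) ℝ) => IsQuadModule M ∧ -1 ∉ M) M)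
    (harch : ∀ p : MvPolynomial (Fin n) ℝ, ∃ c : ℝ, C c - p ∈ M) :
    ∃ y : Fin n → ℝ, ∀ m ∈ M, 0 ≤ eval y m := by
  obtain ⟨hQ, h1⟩ := hM.prop
  have hnear (p : MvPolynomial (Fin n) ℝ) : ∃ y : ℝ, p - C y ∈ hQ.infinitesimals harch := by
    obtain ⟨c, hc⟩ := harch p
    obtain ⟨d, hd⟩ := harch (-p)
    have hne : {r : ℝ | p - C r ∈ M}.Nonempty := by
      refine ⟨-d, ?_⟩
      rw [Set.mem_ofPred_eq, C_neg]
      convert hd using 1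
      ring
    have hbdd : BddAbove {r : ℝ | p - C r ∈ M} := by
      refine ⟨c, fun r hr => ?_⟩
      have := add_mem hc hr
      rw [sub_add_sub_cancel, ← C_sub, hQ.C_mem_iff h1] at this
      linarith
    refine ⟨sSup {r : ℝ | p - C r ∈ M}, fun ε hε => ?_⟩
    set y := sSup {r : ℝ | p - C r ∈ M}
    have hδ : 0 < √ε := Real.sqrt_pos.2 hε
    rw [← Real.sq_sqrt hε.le]
    refine hQ.C_sq_sub_sq_mem hδ ?_ ?_
    · have h2 : p - C (y + √ε) ∉ M := fun h => by
        have := le_csSup hbdd h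
        linarith
      have h3 := (mem_or_neg_mem hM _).resolve_left h2
      rw [C_add] at h3
      convert h3 using 1
      ring
    · obtain ⟨r, hr, hyr⟩ := exists_lt_of_lt_csSup hne (sub_lt_self y hδ)
      have : C √ε + (p - C y) = C (r - (y - √ε)) + (p - C r) := by
        rw [C_sub, C_sub]
        ring
      rw [this]
      exact add_mem (hQ.C_mem (sub_nonneg.2 hyr.le)) hr
  choose y hy using fun i => hnear (X i)
  have heval (p : MvPolynomial (Fin n) ℝ) : p - C (eval y p) ∈ hQ.infinitesimals harch := by
    induction p using MvPolynomial.induction_on with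
    | C r => simp
    | add p q hp hq =>
      convert add_mem hp hq using 1
      rw [map_add, C_add]
      ring
    | mul_X p i hp =>
      convert add_mem (Ideal.mul_mem_left _ (X i) hp) (Ideal.mul_mem_left _ (C (eval y p)) (hy i))
        using 1
      rw [map_mul, eval_X, C_mul]
      ring
  refine ⟨y, fun m hm => le_of_forall_pos_le_add fun δ hδ => ?_⟩
  have := add_mem hm (hQ.C_sub_mem hδ (heval m _ (by positivity)))
  rw [← hQ.C_mem_iff h1, C_add]
  convert this using 1
  ring

/-- Putinar's theorem for an abstract Archimedean quadratic module. -/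
theorem mem_of_forall_eval_pos (hM : IsQuadModule M)
    (harch : ∀ p : MvPolynomial (Fin n) ℝ, ∃ c : ℝ, C c - p ∈ M) {f : MvPolynomial (Fin n) ℝ}
    (hf : ∀ y : Fin n → ℝ, (∀ q ∈ M, 0 ≤ eval y q) → 0 < eval y f) : f ∈ M := by
  obtain ⟨q, hq, p, hp, hpq⟩ : ∃ q ∈ M, ∃ p ∈ sosCone n, p * f - 1 = q := by
    by_contra! hcon
    obtain ⟨M', hle, hM'⟩ := (hM.sup_map (-f)).exists_maximal fun h => by
      obtain ⟨m, hm, z, ⟨σ, hσ, rfl⟩, h⟩ := AddSubmonoid.mem_sup.1 h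
      refine hcon m hm σ hσ ?_
      simp only [AddMonoidHom.coe_mulRight, mul_neg] at h
      linear_combination -h
    obtain ⟨y, hy⟩ := exists_point hM' fun p => by
      obtain ⟨c, hc⟩ := harch p
      exact ⟨c, hle (AddSubmonoid.mem_sup_left hc)⟩
    have h1 := hf y fun q hq => hy q (hle (AddSubmonoid.mem_sup_left hq))
    have h2 := hy (-f) (hle (AddSubmonoid.mem_sup_right
      ⟨1, by simpa using isQuadModule_sosCone.sq_mem (1 : MvPolynomial (Fin n) ℝ), by simp⟩))
    rw [map_neg] at h2
    linarith
  obtain ⟨c₁, h₁⟩ := harch (p ^ 2 * f)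
  obtain ⟨c₂, h₂⟩ := harch p
  obtain ⟨k, hk0, hk1, hk2⟩ : ∃ k : ℝ, 0 < k ∧ c₁ ≤ k ∧ c₂ ≤ 2 * k :=
    ⟨|c₁| + |c₂| + 1, by positivity, by linarith [le_abs_self c₁, abs_nonneg c₂],
      by linarith [le_abs_self c₂, abs_nonneg c₁, abs_nonneg c₂]⟩
  have h₁' : C k - p ^ 2 * f ∈ M := by
    convert add_mem (hM.C_mem (sub_nonneg.2 hk1)) h₁ using 1
    rw [C_sub]
    ring
  have h₂' : C (2 * k) - p ∈ M := by
    convert add_mem (hM.C_mem (sub_nonneg.2 hk2)) h₂ using 1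
    rw [C_sub]
    ring
  have step (r : ℝ) (hr : 0 ≤ r) (h : f + C r ∈ M) : f + C (r - 1 / k) ∈ M := by
    have h3 : (C (1 / k) * C k : MvPolynomial (Fin n) ℝ) = 1 := by
      rw [← C_mul, ← C_1]
      congr 1
      field_simp
    have h4 : (C k - p) ^ 2 * (f + C r) + C (2 * k) * q + C r * (p * (C (2 * k) - p)) +
        (C k - p ^ 2 * f) ∈ M :=
      add_mem (add_mem (add_mem (hM.sq_mul_mem _ _ h) (hM.C_mul_mem (by positivity) hq))
        (hM.C_mul_mem hr (hM.sosCone_mul_mem hp h₂'))) h₁'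
    have h5 : f + C (r - 1 / k) = C (1 / k) ^ 2 * ((C k - p) ^ 2 * (f + C r) + C (2 * k) * q +
        C r * (p * (C (2 * k) - p)) + (C k - p ^ 2 * f)) := by
      rw [C_sub, C_mul, show (C 2 : MvPolynomial (Fin n) ℝ) = 2 from rfl, ← hpq]
      linear_combination (-(f + C r) * (C (1 / k) * C k + 1) + C (1 / k)) * h3
    rw [h5]
    exact hM.sq_mul_mem _ _ h4
  obtain ⟨d, hd⟩ := harch (-f)
  rw [sub_neg_eq_add, add_comm] at hd
  have hiter (j : ℕ) : ∃ r : ℝ, f + C r ∈ M ∧ (r ≤ 0 ∨ r ≤ d - j / k) := by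
    induction j with
    | zero => exact ⟨d, hd, by simp⟩
    | succ j ih =>
      obtain ⟨r, hr, h⟩ := ih
      rcases le_total r 0 with hr0 | hr0
      · exact ⟨r, hr, .inl hr0⟩
      · have : 0 ≤ 1 / k := by positivity
        refine ⟨r - 1 / k, step r hr0 hr, ?_⟩
        push_cast
        rw [add_div]
        rcases h with h | h
        · exact .inl (by linarith)
        · exact .inr (by linarith)
  obtain ⟨j, hj⟩ := exists_nat_ge (d * k)
  obtain ⟨r, hr, h⟩ := hiter j
  have hr0 : r ≤ 0 := h.elim id fun h => h.trans (sub_nonpos.2 ((le_div_iff₀ hk0).2 hj))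
  convert add_mem hr (hM.C_mem (neg_nonneg.2 hr0)) using 1
  rw [C_neg]
  ring

end IsQuadModule

end QuadModule

section MomentMatrices

variable {n : ℕ}

/-- The Riesz functional as a linear map. -/
noncomputable def rieszLin (z : (Fin n →₀ ℕ) → ℝ) : MvPolynomial (Fin n) ℝ →ₗ[ℝ] ℝ :=
  (basisMonomials (Fin n) ℝ).constr ℝ z

lemma rieszLin_apply (z : (Fin n →₀ ℕ) → ℝ) (p : MvPolynomial (Fin n) ℝ) :
    rieszLin z p = rieszFun z p := by
  rw [rieszLin, Module.Basis.constr_apply]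
  rfl

lemma rieszLin_monomial (z : (Fin n →₀ ℕ) → ℝ) (α : Fin n →₀ ℕ) (r : ℝ) :
    rieszLin z (monomial α r) = r * z α := by
  have := (basisMonomials (Fin n) ℝ).constr_basis ℝ z α
  rw [coe_basisMonomials] at this
  rw [show monomial α r = r • monomial α (1 : ℝ) by rw [smul_monomial, smul_eq_mul, mul_one],
    map_smul, rieszLin, this, smul_eq_mul]

lemma rieszFun_monomial_one (L : MvPolynomial (Fin n) ℝ →ₗ[ℝ] ℝ) (p : MvPolynomial (Fin n) ℝ) :
    rieszFun (fun α => L (monomial α 1)) p = L p := by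
  rw [← rieszLin_apply]
  congr 1
  refine (basisMonomials (Fin n) ℝ).ext fun α => ?_
  simp [rieszLin_monomial]

lemma rieszLin_monomial_mul (z : (Fin n →₀ ℕ) → ℝ) (α : Fin n →₀ ℕ) (r : ℝ)
    (f : MvPolynomial (Fin n) ℝ) :
    rieszLin z (monomial α r * f) = r * ∑ γ ∈ f.support, f.coeff γ * z (α + γ) := by
  conv_lhs => rw [f.as_sum]
  rw [Finset.mul_sum, map_sum, Finset.mul_sum]
  refine Finset.sum_congr rfl fun γ _ => ?_
  rw [monomial_mul, rieszLin_monomial]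
  ring

lemma mem_monLE {t : ℕ} {α : Fin n →₀ ℕ} : α ∈ monLE n t ↔ ∑ i, α i ≤ t := by
  simp only [monLE, Finset.mem_image, Finset.mem_filter, Fintype.mem_piFinset, Finset.mem_range]
  refine ⟨?_, fun h => ⟨α, ⟨fun i => ?_, h⟩, by ext; simp⟩⟩
  · rintro ⟨a, ⟨-, h⟩, rfl⟩
    simpa using h
  · exact Nat.lt_succ_of_le ((Finset.single_le_sum (fun _ _ => Nat.zero_le _)
      (Finset.mem_univ i)).trans h)

/-- The polynomial with a given vector of coefficients. -/
noncomputable def polyOfVec {t : ℕ} (v : monLE n t → ℝ) : MvPolynomial (Fin n) ℝ :=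
  ∑ I, monomial I.1 (v I)

lemma polyOfVec_coeff {t : ℕ} {p : MvPolynomial (Fin n) ℝ} (hp : p.totalDegree ≤ t) :
    polyOfVec (fun I : monLE n t => p.coeff I.1) = p := by
  rw [polyOfVec, Finset.sum_coe_sort (monLE n t) fun α => monomial α (p.coeff α)]
  conv_rhs => rw [p.as_sum]
  refine (Finset.sum_subset (fun α hα => mem_monLE.2 ?_) fun α _ hα => ?_).symm
  · refine le_trans ?_ ((le_totalDegree hα).trans hp)
    rw [Finsupp.sum_fintype _ _ fun _ => rfl]
  · rw [notMem_support_iff.1 hα, monomial_zero]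

lemma dotProduct_localizingMat (t : ℕ) (f : MvPolynomial (Fin n) ℝ) (z : (Fin n →₀ ℕ) → ℝ)
    (v : monLE n t → ℝ) :
    star v ⬝ᵥ (localizingMat n t f z).mulVec v = rieszFun z (polyOfVec v ^ 2 * f) := by
  rw [← rieszLin_apply, polyOfVec, sq, Finset.sum_mul_sum, Finset.sum_mul, map_sum, dotProduct]
  refine Finset.sum_congr rfl fun I _ => ?_
  rw [Finset.sum_mul, map_sum, Matrix.mulVec, dotProduct, Finset.mul_sum]
  refine Finset.sum_congr rfl fun J _ => ?_
  rw [monomial_mul, rieszLin_monomial_mul, localizingMat, star_trivial]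
  ring

lemma localizingMat_isHermitian (t : ℕ) (f : MvPolynomial (Fin n) ℝ) (z : (Fin n →₀ ℕ) → ℝ) :
    (localizingMat n t f z).IsHermitian := by
  ext I J
  simp [localizingMat, add_comm]

lemma localizingMat_posSemidef_iff {t : ℕ} {f : MvPolynomial (Fin n) ℝ}
    {z : (Fin n →₀ ℕ) → ℝ} : (localizingMat n t f z).PosSemidef ↔
      ∀ p : MvPolynomial (Fin n) ℝ, p.totalDegree ≤ t → 0 ≤ rieszFun z (p ^ 2 * f) := by
  refine ⟨fun h p hp => ?_, fun h =>
    .of_dotProduct_mulVec_nonneg (localizingMat_isHermitian t f z) fun v => ?_⟩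
  · rw [← polyOfVec_coeff hp, ← dotProduct_localizingMat]
    exact h.dotProduct_mulVec_nonneg _
  · rw [dotProduct_localizingMat]
    refine h _ (totalDegree_finsetSum_le fun I _ => (totalDegree_monomial_le _ _).trans ?_)
    have := mem_monLE.1 I.2
    rwa [Finsupp.sum_fintype _ _ fun _ => rfl]

lemma momentMat_eq_localizingMat (k : ℕ) (z : (Fin n →₀ ℕ) → ℝ) :
    momentMat n k z = localizingMat n k 1 z := by
  ext I J
  have : (1 : MvPolynomial (Fin n) ℝ).support = {0} := by
    rw [← C_1, C_apply, support_monomial, if_neg one_ne_zero]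
  simp [momentMat, localizingMat, this]

lemma momentMat_posSemidef_iff {k : ℕ} {z : (Fin n →₀ ℕ) → ℝ} : (momentMat n k z).PosSemidef ↔
      ∀ p : MvPolynomial (Fin n) ℝ, p.totalDegree ≤ k → 0 ≤ rieszFun z (p ^ 2) := by
  simp [momentMat_eq_localizingMat, localizingMat_posSemidef_iff]

variable {m s : ℕ} {c : Fin m → ℝ} {a : Fin m → MvPolynomial (Fin n) ℝ}
  {b : MvPolynomial (Fin n) ℝ} {g : Fin s → MvPolynomial (Fin n) ℝ}

lemma momFeas.mono {k₁ k₂ : ℕ} (h : k₁ ≤ k₂) {z : (Fin n →₀ ℕ) → ℝ} (hz : momFeas c a g k₂ z) :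
    momFeas c a g k₁ z := by
  obtain ⟨hc, hM, hL⟩ := hz
  refine ⟨hc, momentMat_posSemidef_iff.2 fun p hp => momentMat_posSemidef_iff.1 hM p (hp.trans h),
    fun j => localizingMat_posSemidef_iff.2 fun p hp =>
      localizingMat_posSemidef_iff.1 (hL j) p (hp.trans ?_)⟩
  exact Nat.sub_le_sub_right h _

lemma pmom_anti : Antitone (pmom c a b g) := fun _ _ h =>
  sSup_le_sSup (Set.image_mono fun _ hz => momFeas.mono h hz)

end MomentMatrices

section QuadraticModuleOfConstraints

variable {n s : ℕ}

/-- The quadratic module generated by `g`, as an additive submonoid. -/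
noncomputable def qmod (g : Fin s → MvPolynomial (Fin n) ℝ) :
    AddSubmonoid (MvPolynomial (Fin n) ℝ) :=
  AddSubmonoid.closure {x | ∃ p, x = p ^ 2 ∨ ∃ j, x = p ^ 2 * g j}

variable {g : Fin s → MvPolynomial (Fin n) ℝ}

lemma isQuadModule_qmod : IsQuadModule (qmod g) where
  sq_mem p := AddSubmonoid.subset_closure ⟨p, .inl rfl⟩
  sq_mul_mem p x hx := by
    induction hx using AddSubmonoid.closure_induction with
    | mem x hx =>
      obtain ⟨q, rfl | ⟨j, rfl⟩⟩ := hx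
      · exact AddSubmonoid.subset_closure ⟨p * q, .inl (by ring)⟩
      · exact AddSubmonoid.subset_closure ⟨p * q, .inr ⟨j, by ring⟩⟩
    | zero => simp
    | add x y _ _ hx hy => rw [mul_add]; exact add_mem hx hy

lemma SOSPoly.mem_sosCone {p : MvPolynomial (Fin n) ℝ} (hp : SOSPoly p) : p ∈ sosCone n := by
  obtain ⟨t, q, rfl⟩ := hp
  exact sum_mem fun i _ => isQuadModule_sosCone.sq_mem _

lemma QModMem.mem_qmod {p : MvPolynomial (Fin n) ℝ} (hp : QModMem g p) : p ∈ qmod g := by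
  obtain ⟨σ₀, σ, h₀, hσ, rfl⟩ := hp
  refine add_mem (isQuadModule_qmod.sosCone_le h₀.mem_sosCone) (sum_mem fun j _ =>
    isQuadModule_qmod.sosCone_mul_mem (hσ j).mem_sosCone
      (AddSubmonoid.subset_closure ⟨1, .inr ⟨j, by simp⟩⟩))

lemma eval_nonneg_of_mem_qmod {p : MvPolynomial (Fin n) ℝ} (hp : p ∈ qmod g) {y : Fin n → ℝ}
    (hy : y ∈ indexSet g) : 0 ≤ eval y p := by
  induction hp using AddSubmonoid.closure_induction with
  | mem x hx =>
    obtain ⟨q, rfl | ⟨j, rfl⟩⟩ := hx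
    · rw [map_pow]; positivity
    · rw [map_mul, map_pow]
      exact mul_nonneg (sq_nonneg _) (hy j)
  | zero => simp
  | add x z _ _ hx hz => rw [map_add]; exact add_nonneg hx hz

lemma QMArchimedean.exists_C_sub_mem_qmod (hg : QMArchimedean g) (p : MvPolynomial (Fin n) ℝ) :
    ∃ r : ℝ, C r - p ∈ qmod g := by
  obtain ⟨ψ, hψ, hcomp⟩ := hg
  obtain ⟨N, hN⟩ := exists_C_sub_mem_preord hcomp
  exact exists_C_sub_mem isQuadModule_qmod.sq_mem isQuadModule_qmod.sq_mul_mem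
    (mem_of_mem_preord_singleton hN isQuadModule_qmod.sq_mem
      fun p => isQuadModule_qmod.sq_mul_mem p ψ hψ.mem_qmod) p

/-- Putinar's Positivstellensatz. -/
theorem QMArchimedean.mem_qmod_of_pos (hg : QMArchimedean g) {f : MvPolynomial (Fin n) ℝ}
    (hf : ∀ y ∈ indexSet g, 0 < eval y f) : f ∈ qmod g :=
  isQuadModule_qmod.mem_of_forall_eval_pos hg.exists_C_sub_mem_qmod fun y hy => hf y fun j =>
    hy _ (AddSubmonoid.subset_closure ⟨1, .inr ⟨j, by simp⟩⟩)

lemma QMArchimedean.isCompact_indexSet (hg : QMArchimedean g) : IsCompact (indexSet g) := by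
  obtain ⟨ψ, hψ, hcomp⟩ := hg
  refine hcomp.of_isClosed_subset ?_ fun y hy => eval_nonneg_of_mem_qmod hψ.mem_qmod hy
  rw [indexSet, Set.ofPred_forall]
  exact isClosed_iInter fun j => isClosed_le continuous_const (MvPolynomial.continuous_eval _)

variable {m : ℕ} {c : Fin m → ℝ} {a : Fin m → MvPolynomial (Fin n) ℝ}

/-- Riesz functionals feasible for high enough relaxations are nonnegative on `qmod g`. -/
lemma exists_rieszFun_nonneg {p : MvPolynomial (Fin n) ℝ} (hp : p ∈ qmod g) :
    ∃ K, ∀ k, K ≤ k → ∀ z, momFeas c a g k z → 0 ≤ rieszFun z p := by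
  induction hp using AddSubmonoid.closure_induction with
  | mem x hx =>
    obtain ⟨q, rfl | ⟨j, rfl⟩⟩ := hx
    · exact ⟨q.totalDegree, fun k hk z hz => momentMat_posSemidef_iff.1 hz.2.1 q hk⟩
    · exact ⟨q.totalDegree + halfCeil (g j).totalDegree, fun k hk z hz =>
        localizingMat_posSemidef_iff.1 (hz.2.2 j) q (Nat.le_sub_of_add_le hk)⟩
  | zero => exact ⟨0, fun k _ z _ => by simp [← rieszLin_apply]⟩
  | add x y _ _ hx hy =>
    obtain ⟨K₁, h₁⟩ := hx
    obtain ⟨K₂, h₂⟩ := hy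
    refine ⟨max K₁ K₂, fun k hk z hz => ?_⟩
    rw [← rieszLin_apply, map_add, rieszLin_apply, rieszLin_apply]
    exact add_nonneg (h₁ k (le_of_max_le_left hk) z hz) (h₂ k (le_of_max_le_right hk) z hz)

end QuadraticModuleOfConstraints

section Duality

variable {n m s : ℕ} {c : Fin m → ℝ} {a : Fin m → MvPolynomial (Fin n) ℝ}
  {b : MvPolynomial (Fin n) ℝ} {g : Fin s → MvPolynomial (Fin n) ℝ} {pstar : ℝ}

/-- The polynomials nonnegative on a set, as a cone. -/
def nonnegCone (S : Set (Fin n → ℝ)) : PointedCone ℝ (MvPolynomial (Fin n) ℝ) where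
  carrier := {p | ∀ y ∈ S, 0 ≤ eval y p}
  add_mem' hp hq y hy := by
    rw [map_add]
    exact add_nonneg (hp y hy) (hq y hy)
  zero_mem' y _ := by simp
  smul_mem' r p hp y hy := by
    change 0 ≤ eval y ((r : ℝ) • p)
    rw [smul_eval]
    exact mul_nonneg r.2 (hp y hy)

lemma nonneg_of_recession (hglb : IsGLB {v : ℝ | ∃ x, isFeasible a b g x ∧ v = ∑ i, c i * x i}
    pstar) {x d : Fin m → ℝ} (hx : isFeasible a b g x)
    (hd : ∀ y ∈ indexSet g, 0 ≤ ∑ i, d i * eval y (a i)) : 0 ≤ ∑ i, c i * d i := by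
  by_contra! hneg
  have hfar (r : ℝ) (hr : 0 ≤ r) : pstar ≤ ∑ i, c i * x i + r * ∑ i, c i * d i := by
    refine hglb.1 ⟨fun i => x i + r * d i, fun y hy => ?_, ?_⟩
    · have h₁ := hx y hy
      have h₂ := mul_nonneg hr (hd y hy)
      simp only [add_mul, Finset.sum_add_distrib, mul_assoc, ← Finset.mul_sum]
      linarith
    · simp only [mul_add, Finset.sum_add_distrib, mul_left_comm _ r, ← Finset.mul_sum]
  have h0 := hfar 0 le_rfl
  have h1 := hfar ((∑ i, c i * x i - pstar + 1) / -∑ i, c i * d i)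
    (div_nonneg (by linarith) (by linarith))
  rw [div_mul_eq_mul_div, div_neg, mul_div_cancel_right₀ _ hneg.ne] at h1
  linarith

lemma nonneg_of_homogenized (hfeas : ∃ x, isFeasible a b g x)
    (hglb : IsGLB {v : ℝ | ∃ x, isFeasible a b g x ∧ v = ∑ i, c i * x i} pstar)
    {x : Fin m → ℝ} {t : ℝ}
    (h : ∀ y ∈ indexSet g, 0 ≤ (∑ i, x i * eval y (a i)) + t * eval y b) :
    0 ≤ (∑ i, c i * x i) - t * pstar := by
  rcases lt_or_ge 0 t with ht | ht
  · have : pstar ≤ t⁻¹ * ∑ i, c i * x i := by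
      refine hglb.1 ⟨fun i => t⁻¹ * x i, fun y hy => ?_, ?_⟩
      · have := mul_nonneg (inv_nonneg.2 ht.le) (h y hy)
        rw [mul_add, inv_mul_cancel_left₀ ht.ne'] at this
        simpa only [mul_assoc, ← Finset.mul_sum] using this
      · simp only [mul_left_comm _ t⁻¹, ← Finset.mul_sum]
    have := mul_le_mul_of_nonneg_left this ht.le
    rw [mul_inv_cancel_left₀ ht.ne'] at this
    linarith
  · have key (x' : Fin m → ℝ) (hx' : isFeasible a b g x') :
        0 ≤ (∑ i, c i * x i) - t * ∑ i, c i * x' i := by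
      have := nonneg_of_recession hglb (d := fun i => x i - t * x' i) hx' fun y hy => by
        have h₁ := h y hy
        have h₂ := mul_nonneg (neg_nonneg.2 ht) (hx' y hy)
        simp only [sub_mul, Finset.sum_sub_distrib, mul_assoc, ← Finset.mul_sum]
        linarith
      simpa only [mul_sub, Finset.sum_sub_distrib, mul_left_comm _ t, ← Finset.mul_sum]
        using this
    rcases ht.lt_or_eq with ht | rfl
    · have : (∑ i, c i * x i) / t ≤ pstar := hglb.2 fun v ⟨x', hx', hv⟩ => by
        rw [hv, div_le_iff_of_neg ht]
        linarith [key x' hx']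
      rw [div_le_iff_of_neg ht] at this
      linarith
    · obtain ⟨x', hx'⟩ := hfeas
      simpa using key x' hx'

/-- Strong duality: the optimal value is attained by a functional nonnegative on the index set. -/
lemma exists_dual_functional (hfeas : ∃ x, isFeasible a b g x)
    (hglb : IsGLB {v : ℝ | ∃ x, isFeasible a b g x ∧ v = ∑ i, c i * x i} pstar)
    (hS : IsCompact (indexSet g))
    (hslater : ∃ x : Fin m → ℝ, ∀ y ∈ indexSet g, 0 < (∑ i, x i * eval y (a i)) + eval y b) :
    ∃ L : MvPolynomial (Fin n) ℝ →ₗ[ℝ] ℝ, (∀ p, (∀ y ∈ indexSet g, 0 ≤ eval y p) → 0 ≤ L p) ∧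
      (∀ i, L (a i) = c i) ∧ L b = -pstar := by
  classical
  let Φ : (Fin m → ℝ) × ℝ →ₗ[ℝ] MvPolynomial (Fin n) ℝ :=
    (Fintype.linearCombination ℝ a).coprod (LinearMap.toSpanSingleton ℝ _ b)
  let φ : (Fin m → ℝ) × ℝ →ₗ[ℝ] ℝ :=
    (Fintype.linearCombination ℝ c).coprod (LinearMap.toSpanSingleton ℝ _ (-pstar))
  have hΦ (w) (y : Fin n → ℝ) :
      eval y (Φ w) = (∑ i, w.1 i * eval y (a i)) + w.2 * eval y b := by
    simp [Φ, Fintype.linearCombination_apply, smul_eval]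
  have hφ (w) : φ w = (∑ i, c i * w.1 i) - w.2 * pstar := by
    simp [φ, Fintype.linearCombination_apply, sub_eq_add_neg, mul_comm]
  have hpos (w) (h : ∀ y ∈ indexSet g, 0 ≤ eval y (Φ w)) : 0 ≤ φ w := by
    rw [hφ]
    exact nonneg_of_homogenized hfeas hglb fun y hy => hΦ w y ▸ h y hy
  have hker (w) (h : Φ w = 0) : φ w = 0 := by
    refine le_antisymm ?_ (hpos w (by simp [h]))
    have := hpos (-w) (by simp [h])
    rwa [map_neg, neg_nonneg] at this
  obtain ⟨ρ, hρ⟩ := Φ.rangeRestrict.exists_rightInverse_of_surjective Φ.range_rangeRestrict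
  have hρ' (p : LinearMap.range Φ) : Φ (ρ p) = p :=
    congrArg Subtype.val (LinearMap.congr_fun hρ p)
  obtain ⟨L, hL, hLpos⟩ := riesz_extension (nonnegCone (indexSet g))
    ⟨LinearMap.range Φ, φ ∘ₗ ρ⟩ (fun p hp => hpos _ fun y hy => by
      rw [hρ']
      exact hp y hy) fun p => by
    obtain ⟨x, hx⟩ := hslater
    have hx' (y) (hy : y ∈ indexSet g) : 0 < eval y (Φ (x, 1)) := by
      rw [hΦ, one_mul]
      exact hx y hy
    obtain ⟨B, hB⟩ := hS.bddBelow_image (f := fun y => eval y p / eval y (Φ (x, 1)))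
      ((continuous_eval _).continuousOn.div (continuous_eval _).continuousOn
        fun y hy => (hx' y hy).ne')
    refine ⟨⟨Φ (-B • (x, 1)), LinearMap.mem_range_self _ _⟩, fun y hy => ?_⟩
    have := hB (Set.mem_image_of_mem _ hy)
    rw [le_div_iff₀ (hx' y hy)] at this
    change 0 ≤ eval y (Φ (-B • (x, 1)) + p)
    rw [map_smul, map_add, smul_eval]
    linarith
  have hLΦ (w) : L (Φ w) = φ w := by
    rw [hL ⟨Φ w, LinearMap.mem_range_self _ _⟩]
    refine sub_eq_zero.1 ((map_sub φ _ _).symm.trans (hker _ ?_))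
    rw [map_sub, hρ', sub_self]
  refine ⟨L, hLpos, fun i => ?_, ?_⟩
  · simpa [Φ, φ, Fintype.linearCombination_apply_single] using hLΦ (Pi.single i 1, 0)
  · simpa [Φ, φ] using hLΦ (0, 1)

lemma le_pmom (hfeas : ∃ x, isFeasible a b g x)
    (hglb : IsGLB {v : ℝ | ∃ x, isFeasible a b g x ∧ v = ∑ i, c i * x i} pstar)
    (hS : IsCompact (indexSet g))
    (hslater : ∃ x : Fin m → ℝ, ∀ y ∈ indexSet g, 0 < (∑ i, x i * eval y (a i)) + eval y b)
    (k : ℕ) : (pstar : EReal) ≤ pmom c a b g k := by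
  obtain ⟨L, hpos, ha, hb⟩ := exists_dual_functional hfeas hglb hS hslater
  refine le_sSup ⟨fun α => L (monomial α 1), ⟨fun i => ?_,
    momentMat_posSemidef_iff.2 fun p _ => ?_,
    fun j => localizingMat_posSemidef_iff.2 fun p _ => ?_⟩, ?_⟩
  · rw [rieszFun_monomial_one, ha]
  · rw [rieszFun_monomial_one]
    exact hpos _ fun y _ => by rw [map_pow]; positivity
  · rw [rieszFun_monomial_one]
    exact hpos _ fun y hy => by
      rw [map_mul, map_pow]
      exact mul_nonneg (sq_nonneg _) (hy j)
  · simp [rieszFun_monomial_one, hb]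

lemma exists_strictly_feasible_lt
    (hglb : IsGLB {v : ℝ | ∃ x, isFeasible a b g x ∧ v = ∑ i, c i * x i} pstar)
    (hslater : ∃ x : Fin m → ℝ, ∀ y ∈ indexSet g, 0 < (∑ i, x i * eval y (a i)) + eval y b)
    {r : ℝ} (hr : pstar < r) : ∃ x : Fin m → ℝ,
      (∀ y ∈ indexSet g, 0 < (∑ i, x i * eval y (a i)) + eval y b) ∧ ∑ i, c i * x i < r := by
  obtain ⟨_, ⟨x, hx, rfl⟩, hxr⟩ := (isGLB_lt_iff hglb).1 hr
  obtain ⟨z, hz⟩ := hslater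
  obtain ⟨δ, hδ0, hδ1, hδ⟩ : ∃ δ : ℝ, 0 < δ ∧ δ ≤ 1 ∧
      δ * (∑ i, c i * z i - ∑ i, c i * x i) < r - ∑ i, c i * x i := by
    have he := sub_pos.2 hxr
    set e := r - ∑ i, c i * x i
    set D := ∑ i, c i * z i - ∑ i, c i * x i
    have hD := abs_nonneg D
    refine ⟨e / (e + |D| + 1), by positivity, ?_, ?_⟩
    · rw [div_le_one (by positivity)]
      linarith
    · rw [div_mul_eq_mul_div, div_lt_iff₀ (by positivity)]
      exact mul_lt_mul_of_pos_left (by linarith [le_abs_self D]) he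
  refine ⟨fun i => (1 - δ) * x i + δ * z i, fun y hy => ?_, ?_⟩
  · have h₁ := mul_nonneg (sub_nonneg.2 hδ1) (hx y hy)
    have h₂ := mul_pos hδ0 (hz y hy)
    simp only [add_mul, Finset.sum_add_distrib, mul_assoc, ← Finset.mul_sum]
    linarith
  · simp only [mul_add, Finset.sum_add_distrib, mul_left_comm _ δ, mul_left_comm _ (1 - δ),
      ← Finset.mul_sum]
    linarith

lemma eventually_pmom_le (hg : QMArchimedean g) {x : Fin m → ℝ}
    (hx : ∀ y ∈ indexSet g, 0 < (∑ i, x i * eval y (a i)) + eval y b) :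
    ∀ᶠ k in Filter.atTop, pmom c a b g k ≤ ((∑ i, c i * x i : ℝ) : EReal) := by
  have hmem : ∑ i, x i • a i + b ∈ qmod g := hg.mem_qmod_of_pos fun y hy => by
    simpa [smul_eval] using hx y hy
  obtain ⟨K, hK⟩ := exists_rieszFun_nonneg (c := c) (a := a) hmem
  filter_upwards [Filter.eventually_ge_atTop K] with k hk
  refine sSup_le ?_
  rintro _ ⟨z, hz, rfl⟩
  have := hK k hk z hz
  rw [← rieszLin_apply, map_add, map_sum] at this
  simp only [map_smul, rieszLin_apply, hz.1, smul_eq_mul] at this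
  refine EReal.coe_le_coe_iff.2 ?_
  simp only [mul_comm (c _)]
  linarith

end Duality

/-- under the Archimedean and Slater conditions, the moment relaxation
values p^mom_k, k ≥ d_P, are nonincreasing in k, bounded below by p*, and converge
to p* as k → ∞. -/
theorem stmt4 {n m s : ℕ} (c : Fin m → ℝ) (a : Fin m → MvPolynomial (Fin n) ℝ)
    (b : MvPolynomial (Fin n) ℝ) (g : Fin s → MvPolynomial (Fin n) ℝ)
    (pstar : ℝ)
    (hfeas : ∃ x, isFeasible a b g x)
    (hglb : IsGLB {v : ℝ | ∃ x, isFeasible a b g x ∧ v = ∑ i, c i * x i} pstar)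
    (harch : QMArchimedean g)
    (hslater : ∃ x : Fin m → ℝ, ∀ y ∈ indexSet g,
      0 < (∑ i, x i * eval y (a i)) + eval y b) :
    (∀ k₁ k₂ : ℕ, dP a b g ≤ k₁ → k₁ ≤ k₂ → pmom c a b g k₂ ≤ pmom c a b g k₁) ∧
    (∀ k : ℕ, dP a b g ≤ k → (pstar : EReal) ≤ pmom c a b g k) ∧
    Filter.Tendsto (pmom c a b g) Filter.atTop (nhds (pstar : EReal)) := by
  have hle := le_pmom hfeas hglb harch.isCompact_indexSet hslater
  refine ⟨fun k₁ k₂ _ h => pmom_anti h, fun k _ => hle k, tendsto_order.2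
    ⟨fun u hu => .of_forall fun k => hu.trans_le (hle k), fun u hu => ?_⟩⟩
  obtain ⟨r, hpr, hru⟩ := EReal.lt_iff_exists_real_btwn.1 hu
  obtain ⟨x, hx, hxr⟩ := exists_strictly_feasible_lt hglb hslater (EReal.coe_lt_coe_iff.1 hpr)
  filter_upwards [eventually_pmom_le (c := c) harch hx] with k hk
  exact hk.trans_lt ((EReal.coe_lt_coe_iff.2 hxr).trans hru)
end

section
/- Let S = {y ∈ ℝ^n : g_1(y) ≥ 0, …, g_s(y) ≥ 0}. For any polynomial f ∈ ℝ[Y_1,…,Y_n], one has f(y) ≥ 0 for all y ∈ S if and only if f^h(ỹ) ≥ 0 for all ỹ in the closure of S̃_>. -/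
open MvPolynomial

/-- Homogenization of `f` to degree `D` with respect to the new variable Y₀
(the variable of index 0; the original variables Y_i become the variables of
index i.succ). -/
noncomputable def polyHomog {n : ℕ} (D : ℕ) (f : MvPolynomial (Fin n) ℝ) :
    MvPolynomial (Fin (n + 1)) ℝ :=
  ∑ α ∈ f.support,
    MvPolynomial.monomial
      (Finsupp.single (0 : Fin (n + 1)) (D - ∑ i, α i) + Finsupp.mapDomain Fin.succ α)
      (f.coeff α)

/-- The set S̃_> = {yt : g_j^h(yt) ≥ 0, y₀ > 0, ‖yt‖² = 1}. -/
def tildeSPos {n s : ℕ} (g : Fin s → MvPolynomial (Fin n) ℝ) :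
    Set (Fin (n + 1) → ℝ) :=
  {y | (∀ j, 0 ≤ eval y (polyHomog (g j).totalDegree (g j))) ∧ 0 < y 0 ∧
    ∑ i, y i ^ 2 = 1}

/-- The set S̃ = {yt : g_j^h(yt) ≥ 0, y₀ ≥ 0, ‖yt‖² = 1}. -/
def tildeS {n s : ℕ} (g : Fin s → MvPolynomial (Fin n) ℝ) :
    Set (Fin (n + 1) → ℝ) :=
  {y | (∀ j, 0 ≤ eval y (polyHomog (g j).totalDegree (g j))) ∧ 0 ≤ y 0 ∧
    ∑ i, y i ^ 2 = 1}

/-- The set Ŝ = {y : ĝ_j(y) ≥ 0, ‖y‖² = 1}, where ĝ_j(y) = g_j^h(0, y). -/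
def hatS {n s : ℕ} (g : Fin s → MvPolynomial (Fin n) ℝ) : Set (Fin n → ℝ) :=
  {y | (∀ j, 0 ≤ eval (Fin.cons 0 y) (polyHomog (g j).totalDegree (g j))) ∧
    ∑ i, y i ^ 2 = 1}

/-- Evaluating the homogenization at `(c, c y)` gives `c ^ D * f y`. -/
theorem eval_cons_polyHomog {n : ℕ} {D : ℕ} {f : MvPolynomial (Fin n) ℝ}
    (hD : f.totalDegree ≤ D) (c : ℝ) (y : Fin n → ℝ) :
    eval (Fin.cons c (c • y)) (polyHomog D f) = c ^ D * eval y f := by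
  rw [polyHomog, map_sum, eval_eq', Finset.mul_sum]
  refine Finset.sum_congr rfl fun α hα => ?_
  have hdeg : ∑ i, α i ≤ D := by
    refine le_trans ?_ hD
    have h := le_totalDegree hα
    rwa [Finsupp.sum_fintype _ _ fun _ => rfl] at h
  rw [eval_monomial, Finsupp.prod_add_index' (by simp) (by intros; rw [pow_add]),
    Finsupp.prod_single_index (by simp),
    Finsupp.prod_mapDomain_index_inj (Fin.succ_injective n),
    Finsupp.prod_fintype _ _ (by simp)]
  simp only [Fin.cons_zero, Fin.cons_succ, Pi.smul_apply, smul_eq_mul, mul_pow,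
    Finset.prod_mul_distrib, Finset.prod_pow_eq_pow_sum]
  rw [← Nat.sub_add_cancel hdeg, pow_add]
  simp only [Nat.add_sub_cancel]
  ring

/-- For `c > 0`, the signs of the homogenization at `(c, c y)` and of `f` at `y` agree. -/
theorem eval_cons_polyHomog_nonneg_iff {n : ℕ} (f : MvPolynomial (Fin n) ℝ)
    {c : ℝ} (hc : 0 < c) (y : Fin n → ℝ) :
    0 ≤ eval (Fin.cons c (c • y)) (polyHomog f.totalDegree f) ↔ 0 ≤ eval y f := by
  rw [eval_cons_polyHomog le_rfl, mul_nonneg_iff_of_pos_left (pow_pos hc _)]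

/-- f ≥ 0 on S if and only if f^h ≥ 0 on closure(S̃_>). -/
theorem stmt10 {n s : ℕ} (g : Fin s → MvPolynomial (Fin n) ℝ)
    (f : MvPolynomial (Fin n) ℝ) :
    (∀ y ∈ indexSet g, 0 ≤ eval y f) ↔
      ∀ yt ∈ closure (tildeSPos g), 0 ≤ eval yt (polyHomog f.totalDegree f) := by
  constructor
  · intro hf
    have hclosed : IsClosed {yt : Fin (n + 1) → ℝ |
        0 ≤ eval yt (polyHomog f.totalDegree f)} :=
      isClosed_le continuous_const (MvPolynomial.continuous_eval _)
    refine fun yt hyt => closure_minimal (fun z hz => ?_) hclosed hyt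
    obtain ⟨hg, hpos, -⟩ := hz
    have hz : Fin.cons (z 0) (z 0 • ((z 0)⁻¹ • Fin.tail z)) = z := by
      rw [smul_inv_smul₀ hpos.ne', Fin.cons_self_tail]
    rw [Set.mem_ofPred_eq, ← hz, eval_cons_polyHomog_nonneg_iff f hpos]
    refine hf _ fun j => ?_
    rw [← eval_cons_polyHomog_nonneg_iff (g j) hpos, hz]
    exact hg j
  · intro hf y hy
    have hr : 0 < 1 + ∑ i, y i ^ 2 := by positivity
    have hc : 0 < (√(1 + ∑ i, y i ^ 2))⁻¹ := inv_pos.2 (Real.sqrt_pos.2 hr)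
    rw [← eval_cons_polyHomog_nonneg_iff f hc]
    refine hf _ (subset_closure ⟨fun j => ?_, hc, ?_⟩)
    · exact (eval_cons_polyHomog_nonneg_iff (g j) hc y).2 (hy j)
    · simp only [Fin.sum_univ_succ, Fin.cons_zero, Fin.cons_succ, Pi.smul_apply, smul_eq_mul,
        mul_pow, ← Finset.mul_sum, inv_pow, Real.sq_sqrt hr.le]
      field_simp
end

section
/- The homogenized LSIPP value satisfies p̃* ≥ p*, and p̃* = p* if and only if Condition 2 holds for (P): for every ε > 0 there exists a feasible point x^(ε) of (P) with c^T x^(ε) − p* ≤ ε and â(y)^T x^(ε) + b̂(y) ≥ 0 for all y ∈ Ŝ. -/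
open MvPolynomial

/-- ω = max{deg a₁, …, deg a_m, deg b}, the common homogenization degree. -/
def omegaDeg {n m : ℕ} (a : Fin m → MvPolynomial (Fin n) ℝ)
    (b : MvPolynomial (Fin n) ℝ) : ℕ :=
  max (Finset.univ.sup fun i => (a i).totalDegree) b.totalDegree

/-- Feasibility for the homogenized LSIPP problem (8). -/
def isFeasibleH {n m s : ℕ} (a : Fin m → MvPolynomial (Fin n) ℝ)
    (b : MvPolynomial (Fin n) ℝ) (g : Fin s → MvPolynomial (Fin n) ℝ)
    (x : Fin m → ℝ) : Prop :=
  ∀ yt ∈ tildeS g,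
    0 ≤ (∑ i, x i * eval yt (polyHomog (omegaDeg a b) (a i))) +
      eval yt (polyHomog (omegaDeg a b) b)

/-- The optimal value p̃* of the homogenized LSIPP problem (8),
as an extended real. -/
noncomputable def ptilde {n m s : ℕ} (c : Fin m → ℝ)
    (a : Fin m → MvPolynomial (Fin n) ℝ) (b : MvPolynomial (Fin n) ℝ)
    (g : Fin s → MvPolynomial (Fin n) ℝ) : EReal :=
  sInf ((fun x : Fin m → ℝ => ((∑ i, c i * x i : ℝ) : EReal)) ''
    {x | isFeasibleH a b g x})

/-- Condition 2: for every ε > 0 there is a feasible point x of (P) with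
c ᵀ x − p* ≤ ε and â(y)ᵀx + b̂(y) ≥ 0 on Ŝ. -/
def Condition2 {n m s : ℕ} (c : Fin m → ℝ) (a : Fin m → MvPolynomial (Fin n) ℝ)
    (b : MvPolynomial (Fin n) ℝ) (g : Fin s → MvPolynomial (Fin n) ℝ)
    (pstar : ℝ) : Prop :=
  ∀ ε : ℝ, 0 < ε → ∃ x : Fin m → ℝ, isFeasible a b g x ∧
    (∑ i, c i * x i) - pstar ≤ ε ∧
    ∀ y ∈ hatS g,
      0 ≤ (∑ i, x i * eval (Fin.cons 0 y) (polyHomog (omegaDeg a b) (a i))) +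
        eval (Fin.cons 0 y) (polyHomog (omegaDeg a b) b)

/-- Along the ray through `(1, y)`, the degree-`D` homogenization of `f` is `t ^ D * f y`. -/
theorem eval_polyHomog_cons_smul {n : ℕ} {D : ℕ} {f : MvPolynomial (Fin n) ℝ}
    (hD : f.totalDegree ≤ D) (t : ℝ) (y : Fin n → ℝ) :
    eval (Fin.cons t (fun i => t * y i)) (polyHomog D f) = t ^ D * eval y f := by
  rw [polyHomog, map_sum, eval_eq', Finset.mul_sum]
  refine Finset.sum_congr rfl fun α hα => ?_
  have hdeg : ∑ i, α i ≤ D := by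
    have h := le_totalDegree hα
    rw [Finsupp.sum_fintype _ _ (fun _ => rfl)] at h
    exact h.trans hD
  rw [eval_monomial, Finsupp.prod_add_index' (by simp) (by intros; rw [pow_add]),
    Finsupp.prod_single_index (by simp),
    Finsupp.prod_mapDomain_index_inj (Fin.succ_injective n),
    Finsupp.prod_fintype _ _ (by simp)]
  simp only [Fin.cons_zero, Fin.cons_succ, mul_pow, Finset.prod_mul_distrib,
    Finset.prod_pow_eq_pow_sum]
  rw [← Nat.sub_add_cancel hdeg, pow_add, Nat.add_sub_cancel]
  ring

theorem totalDegree_coeff_le_omegaDeg {n m : ℕ} (a : Fin m → MvPolynomial (Fin n) ℝ)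
    (b : MvPolynomial (Fin n) ℝ) (i : Fin m) : (a i).totalDegree ≤ omegaDeg a b :=
  (Finset.le_sup (f := fun i => (a i).totalDegree) (Finset.mem_univ i)).trans (le_max_left _ _)

/-- Along the ray through `(1, y)`, the homogenized constraint is a power of the ray parameter
times the original constraint. -/
theorem homogenized_constraint_cons_smul {n m : ℕ} (a : Fin m → MvPolynomial (Fin n) ℝ)
    (b : MvPolynomial (Fin n) ℝ) (x : Fin m → ℝ) (t : ℝ) (y : Fin n → ℝ) :
    (∑ i, x i * eval (Fin.cons t (fun i => t * y i)) (polyHomog (omegaDeg a b) (a i))) +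
      eval (Fin.cons t (fun i => t * y i)) (polyHomog (omegaDeg a b) b) =
    t ^ omegaDeg a b * ((∑ i, x i * eval y (a i)) + eval y b) := by
  have hb : b.totalDegree ≤ omegaDeg a b := le_max_right _ _
  simp only [eval_polyHomog_cons_smul (totalDegree_coeff_le_omegaDeg a b _)]
  rw [eval_polyHomog_cons_smul hb, mul_add, Finset.mul_sum]
  congr 1
  exact Finset.sum_congr rfl fun i _ => by ring

/-- Feasibility for the homogenized problem is feasibility for the original problem together with
nonnegativity of the top-degree part on the set at infinity. -/
theorem isFeasibleH_iff {n m s : ℕ} (a : Fin m → MvPolynomial (Fin n) ℝ)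
    (b : MvPolynomial (Fin n) ℝ) (g : Fin s → MvPolynomial (Fin n) ℝ) (x : Fin m → ℝ) :
    isFeasibleH a b g x ↔ isFeasible a b g x ∧ ∀ y ∈ hatS g,
      0 ≤ (∑ i, x i * eval (Fin.cons 0 y) (polyHomog (omegaDeg a b) (a i))) +
        eval (Fin.cons 0 y) (polyHomog (omegaDeg a b) b) := by
  constructor
  · refine fun h => ⟨fun y hy => ?_, fun y hy => h _ ⟨hy.1, by simp, ?_⟩⟩
    · have hr : 0 < 1 + ∑ i, y i ^ 2 := by positivity
      set t : ℝ := (√(1 + ∑ i, y i ^ 2))⁻¹ with ht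
      have ht0 : 0 < t := by positivity
      have hmem : (Fin.cons t (fun i => t * y i) : Fin (n + 1) → ℝ) ∈ tildeS g := by
        refine ⟨fun j => ?_, by simpa using ht0.le, ?_⟩
        · rw [eval_polyHomog_cons_smul le_rfl]
          exact mul_nonneg (by positivity) (hy j)
        · simp only [Fin.sum_univ_succ, Fin.cons_zero, Fin.cons_succ, mul_pow]
          rw [← Finset.mul_sum, ht, inv_pow, Real.sq_sqrt hr.le]
          field_simp
      have hx := h _ hmem
      rw [homogenized_constraint_cons_smul] at hx
      exact nonneg_of_mul_nonneg_right hx (by positivity)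
    · simpa [Fin.sum_univ_succ] using hy.2
  · rintro ⟨hS, hinf⟩ z ⟨hg, hz0, hnorm⟩
    rcases hz0.eq_or_lt with h0 | hpos
    · have hz : z = Fin.cons 0 (Fin.tail z) := by rw [h0, Fin.cons_self_tail]
      rw [hz] at hg hnorm ⊢
      exact hinf _ ⟨hg, by simpa [Fin.sum_univ_succ] using hnorm⟩
    · obtain ⟨t, y, ht, rfl⟩ : ∃ (t : ℝ) (y : Fin n → ℝ), 0 < t ∧
          z = Fin.cons t (fun i => t * y i) := by
        refine ⟨z 0, fun i => z i.succ / z 0, hpos, funext fun i => ?_⟩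
        refine Fin.cases (by simp) (fun i => ?_) i
        rw [Fin.cons_succ, mul_div_cancel₀ _ hpos.ne']
      rw [homogenized_constraint_cons_smul]
      refine mul_nonneg (by positivity) (hS y fun j => ?_)
      have hj := hg j
      rw [eval_polyHomog_cons_smul le_rfl] at hj
      exact nonneg_of_mul_nonneg_right hj (by positivity)

/-- p̃* ≥ p*, and p̃* = p* if and only if Condition 2 holds for (P).
(The fact that f ≥ 0 on S iff f^h ≥ 0 on closure(S̃_>) is assumed, as permitted.) -/
theorem stmt12 {n m s : ℕ} (c : Fin m → ℝ) (a : Fin m → MvPolynomial (Fin n) ℝ)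
    (b : MvPolynomial (Fin n) ℝ) (g : Fin s → MvPolynomial (Fin n) ℝ)
    (pstar : ℝ)
    (hfeas : ∃ x, isFeasible a b g x)
    (hglb : IsGLB {v : ℝ | ∃ x, isFeasible a b g x ∧ v = ∑ i, c i * x i} pstar)
    (hprop : ∀ f : MvPolynomial (Fin n) ℝ,
      (∀ y ∈ indexSet g, 0 ≤ eval y f) ↔
        ∀ yt ∈ closure (tildeSPos g), 0 ≤ eval yt (polyHomog f.totalDegree f)) :
    (pstar : EReal) ≤ ptilde c a b g ∧
      (ptilde c a b g = (pstar : EReal) ↔ Condition2 c a b g pstar) := by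
  have hle : (pstar : EReal) ≤ ptilde c a b g := by
    refine le_sInf ?_
    rintro _ ⟨x, hx, rfl⟩
    exact EReal.coe_le_coe_iff.2 (hglb.1 ⟨x, ((isFeasibleH_iff a b g x).1 hx).1, rfl⟩)
  refine ⟨hle, fun heq ε hε => ?_, fun hcond => le_antisymm ?_ hle⟩
  · have hlt : ptilde c a b g < ((pstar + ε : ℝ) : EReal) := by
      rw [heq, EReal.coe_lt_coe_iff]
      linarith
    obtain ⟨_, ⟨x, hx, rfl⟩, hxlt⟩ := sInf_lt_iff.1 hlt
    obtain ⟨hfx, hinf⟩ := (isFeasibleH_iff a b g x).1 hx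
    have hxε := EReal.coe_lt_coe_iff.1 hxlt
    exact ⟨x, hfx, by linarith, hinf⟩
  · refine EReal.le_of_forall_lt_iff_le.1 fun v hv => ?_
    have hv' := EReal.coe_lt_coe_iff.1 hv
    obtain ⟨x, hfx, hxε, hinf⟩ := hcond (v - pstar) (by linarith)
    exact sInf_le_of_le ⟨x, (isFeasibleH_iff a b g x).2 ⟨hfx, hinf⟩, rfl⟩
      (EReal.coe_le_coe_iff.2 (by linarith))
end
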